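/- arXiv:2308.03414 — 11 statements merged into one kernel-verified Lean document; each statement's English description precedes it below -/
import Mathlib

section
/- For every integer k ≥ 1, there exists an integer N = N(k) such that every k-vertex-critical (P5,dart)-free finite simple graph has at most N vertices; equivalently, up to isomorphism there are only finitely many k-vertex-critical (P5,dart)-free graphs. -/
open SimpleGraph

/-- `G` contains an induced subgraph isomorphic to `H`. -/
def ContainsInduced {V : Type*} {W : Type*} (G : SimpleGraph V) (H : SimpleGraph W) : Prop :=
  ∃ f : W ↪ V, ∀ a b, H.Adj a b ↔ G.Adj (f a) (f b)

/-- The path on 5 vertices. -/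
def P5 : SimpleGraph (Fin 5) := SimpleGraph.pathGraph 5

/-- The dart: vertices `0,1,2,3,4` and edges `01, 12, 23, 30, 02, 24`. -/
def dart : SimpleGraph (Fin 5) :=
  SimpleGraph.fromRel (fun a b =>
    (a, b) = (0, 1) ∨ (a, b) = (1, 2) ∨ (a, b) = (2, 3) ∨
    (a, b) = (3, 0) ∨ (a, b) = (0, 2) ∨ (a, b) = (2, 4))

/-- `G` is `k`-vertex-critical: `χ(G) = k` and `χ(G - v) < k` for every vertex `v`. -/
def IsVertexCritical {V : Type*} (G : SimpleGraph V) (k : ℕ) : Prop :=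
  G.chromaticNumber = k ∧
  ∀ v : V, (G.induce {u | u ≠ v}).chromaticNumber < k

variable {V : Type*} {G : SimpleGraph V}

/-- A graph without induced `P5` has no five vertices spanning an induced path. -/
lemma not_inducedPath_of_P5_free (h : ¬ ContainsInduced G P5) {a b c d e : V}
    (hab : G.Adj a b) (hbc : G.Adj b c) (hcd : G.Adj c d) (hde : G.Adj d e)
    (hac : ¬ G.Adj a c) (had : ¬ G.Adj a d) (hae : ¬ G.Adj a e)
    (hbd : ¬ G.Adj b d) (hbe : ¬ G.Adj b e) (hce : ¬ G.Adj c e) : False := by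
  refine h ⟨⟨![a, b, c, d, e], ?_⟩, ?_⟩
  · have h1 := hab.ne
    have h2 := hbc.ne
    have h3 := hcd.ne
    have h4 := hde.ne
    have h5 : a ≠ c := by rintro rfl; exact had hcd
    have h6 : a ≠ d := by rintro rfl; exact hae hde
    have h7 : a ≠ e := by rintro rfl; exact had hde.symm
    have h8 : b ≠ d := by rintro rfl; exact had hab
    have h9 : b ≠ e := by rintro rfl; exact hae hab
    have h10 : c ≠ e := by rintro rfl; exact hbe hbc
    intro i j hij
    fin_cases i <;> fin_cases j <;> simp_all [eq_comm]
  · intro i j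
    change _ ↔ G.Adj (![a, b, c, d, e] i) (![a, b, c, d, e] j)
    simp only [P5, SimpleGraph.pathGraph_adj]
    fin_cases i <;> fin_cases j <;> simp_all [G.adj_comm]

/-- In a dart-free graph, no neighbourhood contains an induced path `p q r` together with a vertex
`e` that has no neighbour on it. -/
lemma not_path_add_vertex_of_dart_free (h : ¬ ContainsInduced G dart) {c p q r e : V}
    (hcp : G.Adj c p) (hcq : G.Adj c q) (hcr : G.Adj c r) (hce : G.Adj c e)
    (hpq : G.Adj p q) (hqr : G.Adj q r) (hne : p ≠ r) (hpr : ¬ G.Adj p r)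
    (hep : ¬ G.Adj e p) (heq : ¬ G.Adj e q) (her : ¬ G.Adj e r) : False := by
  refine h ⟨⟨![q, p, c, r, e], ?_⟩, ?_⟩
  · have h1 := hcp.ne
    have h2 := hcq.ne
    have h3 := hcr.ne
    have h4 := hce.ne
    have h5 := hpq.ne
    have h6 := hqr.ne
    have h7 : e ≠ p := by rintro rfl; exact heq hpq
    have h8 : e ≠ q := by rintro rfl; exact her hqr
    have h9 : e ≠ r := by rintro rfl; exact heq hqr.symm
    intro i j hij
    fin_cases i <;> fin_cases j <;> simp_all [eq_comm]
  · intro i j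
    change _ ↔ G.Adj (![q, p, c, r, e] i) (![q, p, c, r, e] j)
    simp only [dart, SimpleGraph.fromRel_adj]
    fin_cases i <;> fin_cases j <;> simp_all [G.adj_comm]

/-- A family `S i j` (`i < j`) of pairwise nonadjacent non-neighbours of `v`, where `S i j` is
adjacent to `a i` and not to `a j`, for an independent family `a` of neighbours of `v`. -/
structure Separates {ι : Type*} [LinearOrder ι] (G : SimpleGraph V) (v : V) (a : ι → V)
    (S : ι → ι → V) : Prop where
  adj_center : ∀ i, G.Adj v (a i)
  indep : ∀ i j, ¬ G.Adj (a i) (a j)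
  not_adj_center : ∀ i j, i < j → ¬ G.Adj v (S i j)
  adj_left : ∀ i j, i < j → G.Adj (S i j) (a i)
  not_adj_right : ∀ i j, i < j → ¬ G.Adj (S i j) (a j)
  not_adj : ∀ i j i' j', i < j → i' < j' → ¬ G.Adj (S i j) (S i' j')

section Separates

variable {ι : Type*} [LinearOrder ι] {v : V} {a b : ι → V} {S : ι → ι → V}

lemma Separates.adj_of_le (hP : ¬ ContainsInduced G P5) (h : Separates G v a S)
    {l i j : ι} (hli : l ≤ i) (hij : i < j) : G.Adj (S i j) (a l) := by
  rcases hli.eq_or_lt with rfl | hli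
  · exact h.adj_left _ _ hij
  by_contra hn
  exact not_inducedPath_of_P5_free hP (h.adj_left i j hij) (h.adj_center i).symm (h.adj_center l)
    (h.adj_left l i hli).symm (fun e => h.not_adj_center i j hij e.symm) hn
    (h.not_adj _ _ _ _ hij hli) (h.indep i l)
    (fun e => h.not_adj_right l i hli e.symm) (h.not_adj_center l i hli)

lemma Separates.not_adj_of_le (hP : ¬ ContainsInduced G P5) (h : Separates G v a S)
    {l i j : ι} (hij : i < j) (hjl : j ≤ l) : ¬ G.Adj (S i j) (a l) := by
  rcases hjl.eq_or_lt with rfl | hjl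
  · exact h.not_adj_right _ _ hij
  intro hn
  exact not_inducedPath_of_P5_free hP hn (h.adj_center l).symm (h.adj_center j)
    (h.adj_left j l hjl).symm (fun e => h.not_adj_center i j hij e.symm)
    (h.not_adj_right i j hij)
    (h.not_adj _ _ _ _ hij hjl) (h.indep l j)
    (fun e => h.not_adj_right j l hjl e.symm) (h.not_adj_center j l hjl)

lemma Separates.not_adj_partner (hP : ¬ ContainsInduced G P5) (hD : ¬ ContainsInduced G dart)
    (h : Separates G v a S) (hb : ∀ i, G.Adj v (b i)) (hab : ∀ i j, i ≠ j → ¬ G.Adj (a i) (b j))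
    (hpair : (∀ i, a i = b i) ∨ ∀ i, G.Adj (a i) (b i)) {x y l m n o : ι}
    (hxy : x < y) (hyl : y ≤ l) (hlm : l < m) (hmn : m < n) (hno : n < o) :
    ¬ G.Adj (S x y) (b l) := by
  rcases hpair with hpair | hpair
  · rw [← hpair]
    exact h.not_adj_of_le hP hxy hyl
  intro hadj
  have key : ∀ i j, l < i → i < j → G.Adj (S i j) (b l) := by
    intro i j hli hij
    by_contra hn
    exact not_inducedPath_of_P5_free hP hadj (hb l).symm (h.adj_center i)
      (h.adj_left i j hij).symm (fun e => h.not_adj_center x y hxy e.symm)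
      (h.not_adj_of_le hP hxy (hyl.trans hli.le)) (h.not_adj _ _ _ _ hxy hij)
      (fun e => hab i l hli.ne' e.symm) (fun e => hn e.symm) (h.not_adj_center i j hij)
  refine not_path_add_vertex_of_dart_free hD (key m n hlm hmn).symm (hpair l).symm
    (key n o (hlm.trans hmn) hno).symm hadj.symm (h.adj_of_le hP hlm.le hmn)
    (h.adj_of_le hP (hlm.trans hmn).le hno).symm ?_ (h.not_adj _ _ _ _ hmn hno)
    (h.not_adj _ _ _ _ hxy hmn) (h.not_adj_of_le hP hxy hyl) (h.not_adj _ _ _ _ hxy hno)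
  intro e
  exact h.not_adj_right m n hmn (e ▸ h.adj_left n o hno)

end Separates

open OrderDual in
/-- Two families separating matched vertices of disjoint cliques in opposite directions cannot
coexist once there are ten cliques. -/
lemma not_separates_both_directions (hP : ¬ ContainsInduced G P5) (hD : ¬ ContainsInduced G dart)
    {v : V} {a b : Fin 10 → V} {S T : Fin 10 → Fin 10 → V}
    (hS : Separates G v a S)
    (hT : Separates G v (fun i : (Fin 10)ᵒᵈ => b (ofDual i)) (fun i j => T (ofDual i) (ofDual j)))
    (hab : ∀ i j, i ≠ j → ¬ G.Adj (a i) (b j))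
    (hpair : (∀ i, a i = b i) ∨ ∀ i, G.Adj (a i) (b i)) : False := by
  have hb : ∀ i, G.Adj v (b i) := fun i => hT.adj_center (toDual i)
  have hTge : ∀ l i j : Fin 10, i ≤ l → j < i → G.Adj (T i j) (b l) := fun l i j h1 h2 =>
    hT.adj_of_le hP (l := toDual l) (i := toDual i) (j := toDual j) h1 h2
  have hTc : ∀ i j : Fin 10, j < i → ¬ G.Adj v (T i j) := fun i j h =>
    hT.not_adj_center (toDual i) (toDual j) h
  have hSc := hS.not_adj_center
  have hSle : ∀ l i j : Fin 10, l ≤ i → i < j → G.Adj (S i j) (a l) := fun l i j h1 h2 =>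
    hS.adj_of_le hP h1 h2
  have hSgt : ∀ l i j : Fin 10, j ≤ l → i < j → ¬ G.Adj (S i j) (a l) := fun l i j h1 h2 =>
    hS.not_adj_of_le hP h2 h1
  have hSb : ∀ x y l : Fin 10, x < y → y ≤ l → l < 7 → ¬ G.Adj (S x y) (b l) :=
    fun x y l h1 h2 h3 => hS.not_adj_partner hP hD hb hab hpair (m := 7) (n := 8) (o := 9)
      h1 h2 h3 (by decide) (by decide)
  have hTa : ¬ G.Adj (T 4 3) (a 3) :=
    hT.not_adj_partner hP hD (b := fun i => a (ofDual i)) (fun i => hS.adj_center (ofDual i))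
      (fun i j hij e => hab (ofDual j) (ofDual i) (fun e => hij (ofDual.injective e.symm)) e.symm)
      (hpair.imp (fun h i => (h _).symm) (fun h i => (h _).symm))
      (x := toDual 4) (y := toDual 3) (l := toDual 3) (m := toDual 2) (n := toDual 1)
      (o := toDual 0) (by decide) (by decide) (by decide) (by decide) (by decide)
  have cross : ∀ x y l : Fin 10, 3 ≤ x → x < y → y ≤ l → 4 ≤ l → l < 7 →
      G.Adj (S x y) (T 4 3) := by
    intro x y l h3 hxy hyl h4 h7
    by_contra hn
    refine not_inducedPath_of_P5_free hP (hSle 3 x y h3 hxy) (hS.adj_center 3).symm (hb l)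
      (hTge l 4 3 h4 (by decide)).symm (fun e => hSc x y hxy e.symm) (hSb x y l hxy hyl h7) hn
      (hab 3 l ?_) (fun e => hTa e.symm) (hTc 4 3 (by decide))
    rintro rfl
    exact absurd h4 (by decide)
  have hTadj : ∀ i : Fin 10, 4 ≤ i → i < 7 → G.Adj (T 4 3) (a i) := by
    intro i h4 h7
    rcases hpair with hpair | hpair
    · rw [hpair]
      exact hTge i 4 3 h4 (by decide)
    by_contra hn
    have h3 : i ≠ 3 := by
      rintro rfl
      exact absurd h4 (by decide)
    exact not_inducedPath_of_P5_free hP (hpair i) (hTge i 4 3 h4 (by decide)).symm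
      (cross 3 4 i le_rfl (by decide) h4 h4 h7).symm (hSle 3 3 4 le_rfl (by decide))
      (fun e => hn e.symm) (fun e => hSgt i 3 4 h4 (by decide) e.symm) (hS.indep i 3)
      (fun e => hSb 3 4 i (by decide) h4 h7 e.symm) (fun e => hab 3 i h3.symm e.symm) hTa
  refine not_path_add_vertex_of_dart_free hD (hSle 4 5 6 (by decide) (by decide))
    (cross 5 6 6 (by decide) (by decide) (by decide) (by decide) (by decide))
    (hSle 5 5 6 (by decide) (by decide)) (hSle 3 5 6 (by decide) (by decide))
    (hTadj 4 (by decide) (by decide)).symm (hTadj 5 (by decide) (by decide)) ?_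
    (hS.indep 4 5) (hS.indep 3 4) (fun e => hTa e.symm) (hS.indep 3 5)
  intro e
  exact hSgt 5 4 5 le_rfl (by decide) (e ▸ hSle 4 4 5 le_rfl (by decide))

section Ramsey

/-- In a large enough set, some sequence of length `n` has the colour of each pair determined by
the first element of the pair. -/
lemma exists_seq_color_eq_of_lt (κ : Type*) [Fintype κ] (n : ℕ) :
    ∃ N : ℕ, ∀ {α : Type*} (S : Finset α) (col : α → α → κ), N ≤ S.card →
      ∃ (f : Fin n → α) (g : Fin n → κ), (∀ i, f i ∈ S) ∧
        ∀ i j, i < j → f i ≠ f j ∧ col (f i) (f j) = g i := by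
  classical
  induction n with
  | zero =>
    exact ⟨0, fun S col _ => ⟨Fin.elim0, Fin.elim0, fun i => i.elim0, fun i => i.elim0⟩⟩
  | succ n ih =>
    obtain ⟨N, hN⟩ := ih
    refine ⟨Fintype.card κ * N + 1, fun S col hS => ?_⟩
    obtain ⟨x, hx⟩ : S.Nonempty := Finset.card_pos.mp (by omega)
    have : Nonempty κ := ⟨col x x⟩
    obtain ⟨c, -, hc⟩ := Finset.exists_le_card_fiber_of_mul_le_card_of_maps_to
      (s := S.erase x) (t := Finset.univ) (f := col x) (n := N) (fun _ _ => Finset.mem_univ _)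
      Finset.univ_nonempty (by rw [Finset.card_erase_of_mem hx, Finset.card_univ]; omega)
    obtain ⟨f, g, hf, hfg⟩ := hN _ col hc
    simp only [Finset.mem_filter, Finset.mem_erase] at hf
    refine ⟨Fin.cons x f, Fin.cons c g, ?_, ?_⟩
    · intro i
      cases i using Fin.cases with
      | zero => exact hx
      | succ i => exact (hf i).1.2
    · intro i j hij
      cases j using Fin.cases with
      | zero => exact absurd hij (Fin.not_lt_zero i)
      | succ j =>
        cases i using Fin.cases with
        | zero => exact ⟨(hf j).1.1.symm, (hf j).2⟩
        | succ i => exact hfg i j (Fin.succ_lt_succ_iff.mp hij)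

/-- Ramsey's theorem for pairs with finitely many colours. -/
lemma exists_monochromatic_seq (κ : Type*) [Fintype κ] (n : ℕ) :
    ∃ N : ℕ, ∀ {α : Type*} (S : Finset α) (col : α → α → κ), N ≤ S.card →
      ∃ (f : Fin n → α) (c : κ), (∀ i, f i ∈ S) ∧
        ∀ i j, i < j → f i ≠ f j ∧ col (f i) (f j) = c := by
  classical
  obtain ⟨N, hN⟩ := exists_seq_color_eq_of_lt κ (Fintype.card κ * n)
  refine ⟨N + 1, fun {α} S col hS => ?_⟩
  obtain ⟨f, g, hf, hfg⟩ := hN S col (by omega)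
  obtain ⟨x, hx⟩ : S.Nonempty := Finset.card_pos.mp (by omega)
  have : Nonempty κ := ⟨col x x⟩
  obtain ⟨c, hc⟩ := Fintype.exists_le_card_fiber_of_mul_le_card (f := g) (n := n) (by simp)
  let e := Finset.orderEmbOfCardLe _ hc
  have he : ∀ i, g (e i) = c := fun i => by
    simpa using Finset.orderEmbOfCardLe_mem _ hc i
  refine ⟨fun i => f (e i), c, fun i => hf _, fun i j hij => ?_⟩
  have := hfg (e i) (e j) (e.lt_iff_lt.mpr hij)
  exact ⟨this.1, this.2.trans (he i)⟩

end Ramsey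

section Critical

variable {k : ℕ}

lemma IsVertexCritical.colorable (h : IsVertexCritical G k) : G.Colorable k :=
  chromaticNumber_le_iff_colorable.mp h.1.le

lemma IsVertexCritical.pos [Nonempty V] (h : IsVertexCritical G k) : 0 < k := by
  rcases Nat.eq_zero_or_pos k with rfl | hk
  · have := h.2 (Classical.arbitrary V)
    simp at this
  · exact hk

lemma IsVertexCritical.not_colorable [Nonempty V] (h : IsVertexCritical G k) :
    ¬ G.Colorable (k - 1) := by
  intro hc
  have h1 := hc.chromaticNumber_le
  have h2 := h.pos
  rw [h.1, Nat.cast_le] at h1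
  omega

lemma IsVertexCritical.colorable_induce_ne (h : IsVertexCritical G k) (v : V) :
    (G.induce {u | u ≠ v}).Colorable (k - 1) := by
  have : Nonempty V := ⟨v⟩
  have h2 := h.pos
  have h1 := h.2 v
  obtain ⟨m, rfl⟩ : ∃ m, k = m + 1 := ⟨k - 1, by omega⟩
  rw [← chromaticNumber_le_iff_colorable]
  exact Order.le_of_lt_add_one (by simpa using h1)

/-- A vertex-critical graph is a core. -/
lemma IsVertexCritical.surjective (h : IsVertexCritical G k) (f : G →g G) :
    Function.Surjective f := by
  intro u
  have : Nonempty V := ⟨u⟩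
  by_contra hu
  push Not at hu
  obtain ⟨c⟩ := h.colorable_induce_ne u
  refine h.not_colorable ⟨Coloring.mk (fun z => c ⟨f z, hu z⟩) ?_⟩
  intro z z' hz
  exact c.valid (show G.Adj (f z) (f z') from f.map_adj hz)

/-- A vertex-critical graph is connected: a nonempty set closed under adjacency is everything. -/
lemma IsVertexCritical.mem_of_closed (h : IsVertexCritical G k) {S : Set V} {s : V} (hs : s ∈ S)
    (hS : ∀ x ∈ S, ∀ y, G.Adj x y → y ∈ S) (u : V) : u ∈ S := by
  classical
  have : Nonempty V := ⟨u⟩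
  by_contra hu
  obtain ⟨c⟩ := h.colorable_induce_ne u
  obtain ⟨c'⟩ := h.colorable_induce_ne s
  refine h.not_colorable ⟨Coloring.mk (fun z => if hz : z ∈ S
    then c ⟨z, fun e => hu (e ▸ hz)⟩ else c' ⟨z, fun e => hz (e ▸ hs)⟩) ?_⟩
  intro x y hxy
  by_cases hx : x ∈ S
  · have hy := hS x hx y hxy
    simp only [hx, hy, dif_pos]
    exact c.valid (show G.Adj x y from hxy)
  · have hy : y ∉ S := fun hy => hx (hS y hy x hxy.symm)
    simp only [hx, hy, dif_neg, not_false_eq_true]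
    exact c'.valid (show G.Adj x y from hxy)

/-- A vertex-critical `P5`-free graph of bounded degree has bounded order, because it has diameter
at most `3`. -/
lemma IsVertexCritical.card_le_of_degree_le [Fintype V] [DecidableRel G.Adj]
    (h : IsVertexCritical G k) (hP : ¬ ContainsInduced G P5) {d : ℕ} (hd : ∀ v, G.degree v ≤ d) :
    Fintype.card V ≤ (d + 1) ^ 3 := by
  classical
  rcases isEmpty_or_nonempty V with hV | ⟨⟨v⟩⟩
  · simp
  let B : V → Finset V := fun x => insert x (G.neighborFinset x)
  have hB : ∀ x, (B x).card ≤ d + 1 := fun x =>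
    (Finset.card_insert_le _ _).trans (by simpa using hd x)
  let B2 := (B v).biUnion B
  let B3 := B2.biUnion B
  have hB3 : B3.card ≤ (d + 1) ^ 3 := by
    have h1 : B2.card ≤ (B v).card * (d + 1) :=
      Finset.card_biUnion_le_card_mul _ _ _ fun x _ => hB x
    have h2 : B3.card ≤ B2.card * (d + 1) :=
      Finset.card_biUnion_le_card_mul _ _ _ fun x _ => hB x
    calc B3.card ≤ B2.card * (d + 1) := h2
      _ ≤ ((B v).card * (d + 1)) * (d + 1) := by gcongr
      _ ≤ ((d + 1) * (d + 1)) * (d + 1) := by gcongr; exact hB v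
      _ = (d + 1) ^ 3 := by ring
  have memB : ∀ {x y}, y ∈ B x ↔ y = x ∨ G.Adj x y := by simp [B]
  have h01 : ∀ {x}, G.Adj v x → x ∈ B v := fun hx => memB.mpr (Or.inr hx)
  have h12 : ∀ {x y}, x ∈ B v → G.Adj x y → y ∈ B2 := fun hx hxy =>
    Finset.mem_biUnion.mpr ⟨_, hx, memB.mpr (Or.inr hxy)⟩
  have h23 : ∀ {x y}, x ∈ B2 → G.Adj x y → y ∈ B3 := fun hx hxy =>
    Finset.mem_biUnion.mpr ⟨_, hx, memB.mpr (Or.inr hxy)⟩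
  have h12' : ∀ {x}, x ∈ B v → x ∈ B2 := fun hx =>
    Finset.mem_biUnion.mpr ⟨_, hx, memB.mpr (Or.inl rfl)⟩
  have h23' : ∀ {x}, x ∈ B2 → x ∈ B3 := fun hx =>
    Finset.mem_biUnion.mpr ⟨_, hx, memB.mpr (Or.inl rfl)⟩
  have hv : v ∈ B v := memB.mpr (Or.inl rfl)
  have closed : ∀ x ∈ (B3 : Set V), ∀ y, G.Adj x y → y ∈ (B3 : Set V) := by
    intro x hx y hxy
    by_contra hy
    rw [Finset.mem_coe] at hx hy
    have hx2 : x ∉ B2 := fun hx2 => hy (h23 hx2 hxy)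
    obtain ⟨z, hz, hzx⟩ := Finset.mem_biUnion.mp hx
    rcases memB.mp hzx with rfl | hzx
    · exact hx2 hz
    have hz1 : z ∉ B v := fun hz1 => hx2 (h12 hz1 hzx)
    obtain ⟨w, hw, hwz⟩ := Finset.mem_biUnion.mp hz
    rcases memB.mp hwz with rfl | hwz
    · exact hz1 hw
    rcases memB.mp hw with rfl | hvw
    · exact hz1 (h01 hwz)
    exact not_inducedPath_of_P5_free hP hvw hwz hzx hxy (fun e => hz1 (h01 e))
      (fun e => hx2 (h12' (h01 e))) (fun e => hy (h23' (h12' (h01 e))))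
      (fun e => hx2 (h12 hw e)) (fun e => hy (h23' (h12 hw e))) (fun e => hy (h23 hz e))
  have huniv : B3 = Finset.univ := Finset.eq_univ_of_forall fun u =>
    h.mem_of_closed (S := (B3 : Set V)) (h23' (h12' hv)) closed u
  rw [← Finset.card_univ, ← huniv]
  exact hB3

end Critical

section Neighborhood

/-- The neighbours of `v` that equal `x` or have `x` as their only neighbour in `I`. -/
def privateNbrs (G : SimpleGraph V) (v : V) (I : Finset V) (x : V) : Set V :=
  {z | G.Adj v z ∧ (z = x ∨ G.Adj x z ∧ ∀ y ∈ I, y ≠ x → ¬ G.Adj y z)}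

/-- `I` is a maximal independent set of the neighbourhood of `v`, with at least three elements. -/
structure IsMaxIndepNbrs (G : SimpleGraph V) (v : V) (I : Finset V) : Prop where
  adj : ∀ x ∈ I, G.Adj v x
  indep : ∀ x ∈ I, ∀ y ∈ I, ¬ G.Adj x y
  maximal : ∀ z, G.Adj v z → z ∉ I → ∃ y ∈ I, G.Adj y z
  card : 3 ≤ I.card

variable {v : V} {I : Finset V}

namespace IsMaxIndepNbrs

lemma exists_ne_ne (h : IsMaxIndepNbrs G v I) (x y : V) : ∃ z ∈ I, z ≠ x ∧ z ≠ y := by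
  classical
  have h1 : ({x, y} : Finset V).card < I.card := Finset.card_le_two.trans_lt h.card
  obtain ⟨z, hz, hzn⟩ := Finset.exists_mem_notMem_of_card_lt_card h1
  exact ⟨z, hz, by simpa using hzn⟩

lemma self_mem (h : IsMaxIndepNbrs G v I) {x : V} (hx : x ∈ I) : x ∈ privateNbrs G v I x :=
  ⟨h.adj x hx, Or.inl rfl⟩

lemma not_adj_of_mem (h : IsMaxIndepNbrs G v I) {x y z : V} (hx : x ∈ I) (hy : y ∈ I)
    (hxy : y ≠ x) (hz : z ∈ privateNbrs G v I x) : ¬ G.Adj y z := by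
  rcases hz.2 with rfl | hz
  · exact h.indep y hy z hx
  · exact hz.2 y hy hxy

lemma adj_of_mem (hD : ¬ ContainsInduced G dart) (h : IsMaxIndepNbrs G v I) {x z z' : V}
    (hx : x ∈ I) (hz : z ∈ privateNbrs G v I x) (hz' : z' ∈ privateNbrs G v I x) (hne : z ≠ z') :
    G.Adj z z' := by
  by_contra hn
  obtain ⟨y, hy, hyx, -⟩ := h.exists_ne_ne x x
  have h1 := h.not_adj_of_mem hx hy hyx hz
  have h2 := h.not_adj_of_mem hx hy hyx hz'
  rcases hz.2 with rfl | hzx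
  · rcases hz'.2 with rfl | hzx'
    · exact hne rfl
    · exact hn hzx'.1
  · rcases hz'.2 with rfl | hzx'
    · exact hn hzx.1.symm
    · exact not_path_add_vertex_of_dart_free hD hz.1 (h.adj x hx) hz'.1 (h.adj y hy) hzx.1.symm
        hzx'.1 hne hn h1 (h.indep y hy x hx) h2

lemma not_adj_of_mem_of_mem (hD : ¬ ContainsInduced G dart) (h : IsMaxIndepNbrs G v I)
    {x y z z' : V} (hx : x ∈ I) (hy : y ∈ I) (hxy : x ≠ y) (hz : z ∈ privateNbrs G v I x)
    (hz' : z' ∈ privateNbrs G v I y) : ¬ G.Adj z z' := by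
  intro hadj
  obtain ⟨t, ht, htx, hty⟩ := h.exists_ne_ne x y
  have h1 := h.not_adj_of_mem hx ht htx hz
  have h2 := h.not_adj_of_mem hy ht hty hz'
  have h3 := h.not_adj_of_mem hy hx hxy hz'
  rcases hz.2 with rfl | hzx
  · exact h3 hadj
  · refine not_path_add_vertex_of_dart_free hD (h.adj x hx) hz.1 hz'.1 (h.adj t ht) hzx.1 hadj ?_
      h3 (h.indep t ht x hx) h1 h2
    rintro rfl
    exact h.indep y hy x hx (hz'.2.resolve_left hxy).1

lemma disjoint (hD : ¬ ContainsInduced G dart) (h : IsMaxIndepNbrs G v I)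
    {x y z : V} (hx : x ∈ I) (hy : y ∈ I) (hxy : x ≠ y) (hz : z ∈ privateNbrs G v I x) :
    z ∉ privateNbrs G v I y := by
  intro hz'
  rcases hz.2 with rfl | hzx
  · rcases hz'.2 with rfl | hzy
    · exact hxy rfl
    · exact h.indep _ hy _ hx hzy.1
  · exact h.not_adj_of_mem_of_mem hD hx hy hxy (h.self_mem hx) hz' hzx.1

/-- A vertex distinguishing two private neighbourhoods from outside is not a neighbour of `v`. -/
lemma not_adj_center (hD : ¬ ContainsInduced G dart) (h : IsMaxIndepNbrs G v I)
    {x y u u' w : V} (hx : x ∈ I) (hy : y ∈ I) (hu : u ∈ privateNbrs G v I x)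
    (hu' : u' ∈ privateNbrs G v I y) (hw : w ∉ privateNbrs G v I x) (hwu : G.Adj w u)
    (hwu' : ¬ G.Adj w u') : ¬ G.Adj v w := by
  intro hvw
  have hwK : ∀ z ∈ I, w ∉ privateNbrs G v I z := by
    intro z hz hwz
    rcases eq_or_ne z x with rfl | hzx
    · exact hw hwz
    · exact h.not_adj_of_mem_of_mem hD hz hx hzx hwz hu hwu
  have hwI : w ∉ I := fun hwI => hwK w hwI (h.self_mem hwI)
  obtain ⟨y1, hy1, hy1w⟩ := h.maximal w hvw hwI
  obtain ⟨y2, hy2, hy21, hy2w⟩ : ∃ y2 ∈ I, y2 ≠ y1 ∧ G.Adj y2 w := by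
    by_contra hcon
    push Not at hcon
    exact hwK y1 hy1 ⟨hvw, Or.inr ⟨hy1w, hcon⟩⟩
  have hall : ∀ z ∈ I, G.Adj z w := by
    intro z hz
    by_contra hn
    exact not_path_add_vertex_of_dart_free hD (h.adj y1 hy1) hvw (h.adj y2 hy2) (h.adj z hz) hy1w
      hy2w.symm hy21.symm (h.indep y1 hy1 y2 hy2) (h.indep z hz y1 hy1) hn (h.indep z hz y2 hy2)
  obtain ⟨z1, hz1, hz1y, -⟩ := h.exists_ne_ne y y
  obtain ⟨z2, hz2, hz2y, hz21⟩ := h.exists_ne_ne y z1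
  exact not_path_add_vertex_of_dart_free hD (h.adj z1 hz1) hvw (h.adj z2 hz2) hu'.1 (hall z1 hz1)
    (hall z2 hz2).symm hz21.symm (h.indep z1 hz1 z2 hz2)
    (fun e => h.not_adj_of_mem hy hz1 hz1y hu' e.symm) (fun e => hwu' e.symm)
    (fun e => h.not_adj_of_mem hy hz2 hz2y hu' e.symm)

/-- In a vertex-critical graph, two private neighbourhoods with the same colours contain vertices
of the same colour that are distinguished by a non-neighbour of `v`. -/
lemma exists_distinguishing (hD : ¬ ContainsInduced G dart) (h : IsMaxIndepNbrs G v I) {k : ℕ}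
    (hG : IsVertexCritical G k) (c : G.Coloring (Fin k)) {x y : V} (hx : x ∈ I) (hy : y ∈ I)
    (hxy : x ≠ y) (hc : c '' privateNbrs G v I x ⊆ c '' privateNbrs G v I y) :
    ∃ u ∈ privateNbrs G v I x, ∃ u' ∈ privateNbrs G v I y, ∃ w,
      c u = c u' ∧ G.Adj w u ∧ ¬ G.Adj w u' ∧ ¬ G.Adj v w := by
  classical
  by_contra hcon
  push Not at hcon
  have hφ : ∀ z, ∃ z', z ∈ privateNbrs G v I x → z' ∈ privateNbrs G v I y ∧ c z' = c z := by
    intro z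
    by_cases hz : z ∈ privateNbrs G v I x
    · obtain ⟨z', h1, h2⟩ := hc ⟨z, hz, rfl⟩
      exact ⟨z', fun _ => ⟨h1, h2⟩⟩
    · exact ⟨z, fun e => absurd e hz⟩
  choose φ hφ using hφ
  have key : ∀ z z', z ∈ privateNbrs G v I x → z' ∉ privateNbrs G v I x → G.Adj z z' →
      G.Adj (φ z) z' := by
    intro z z' hz hz' hadj
    by_contra hn
    obtain ⟨h1, h2⟩ := hφ z hz
    exact h.not_adj_center hD hx hy hz h1 hz' hadj.symm (fun e => hn e.symm)
      (hcon z hz _ h1 z' h2.symm hadj.symm (fun e => hn e.symm))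
  let f : G →g G :=
    { toFun := fun z => if z ∈ privateNbrs G v I x then φ z else z
      map_rel' := by
        intro z z' hadj
        by_cases hz : z ∈ privateNbrs G v I x <;> by_cases hz' : z' ∈ privateNbrs G v I x <;>
          simp only [hz, hz', if_true, if_false]
        · obtain ⟨h1, h2⟩ := hφ z hz
          obtain ⟨h1', h2'⟩ := hφ z' hz'
          refine h.adj_of_mem hD hy h1 h1' fun e => c.valid hadj ?_
          rw [← h2, ← h2', e]
        · exact key z z' hz hz' hadj
        · exact (key z' z hz' hz hadj.symm).symm
        · exact hadj }
  obtain ⟨z, hz⟩ := hG.surjective f x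
  change (if z ∈ privateNbrs G v I x then φ z else z) = x at hz
  split_ifs at hz with hzx
  · exact h.disjoint hD hx hy hxy (h.self_mem hx) (hz ▸ (hφ z hzx).1)
  · exact hzx (by rw [hz]; exact h.self_mem hx)

end IsMaxIndepNbrs

/-- Independent sets inside neighbourhoods of `k`-vertex-critical (`P5`, dart)-free graphs have
bounded size. -/
lemma exists_card_indep_nbrs_lt (k : ℕ) :
    ∃ N : ℕ, ∀ {V : Type*} {G : SimpleGraph V} {v : V} {I : Finset V}, IsVertexCritical G k →
      ¬ ContainsInduced G P5 → ¬ ContainsInduced G dart → IsMaxIndepNbrs G v I → I.card < N := by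
  classical
  obtain ⟨R, hR⟩ := exists_monochromatic_seq (Fin k × Fin k × Fin k × Fin k) 10
  refine ⟨Fintype.card (Set (Fin k)) * R + 1, fun {V G v I} hG hP hD h => ?_⟩
  by_contra! hcard
  obtain ⟨c⟩ := hG.colorable
  obtain ⟨C, -, hC⟩ := Finset.exists_le_card_fiber_of_mul_le_card_of_maps_to
    (s := I) (t := Finset.univ) (f := fun x => c '' privateNbrs G v I x) (n := R)
    (fun _ _ => Finset.mem_univ _) Finset.univ_nonempty (by rw [Finset.card_univ]; omega)
  have hex : ∀ x y, ∃ u u' w, x ∈ {x ∈ I | c '' privateNbrs G v I x = C} →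
      y ∈ {x ∈ I | c '' privateNbrs G v I x = C} → x ≠ y →
      u ∈ privateNbrs G v I x ∧ u' ∈ privateNbrs G v I y ∧
        c u = c u' ∧ G.Adj w u ∧ ¬ G.Adj w u' ∧ ¬ G.Adj v w := by
    intro x y
    by_cases hxy : x ∈ {x ∈ I | c '' privateNbrs G v I x = C} ∧
      y ∈ {x ∈ I | c '' privateNbrs G v I x = C} ∧ x ≠ y
    · obtain ⟨hx, hy, hne⟩ := hxy
      rw [Finset.mem_filter] at hx hy
      obtain ⟨u, hu, u', hu', w, hw⟩ := h.exists_distinguishing hD hG c hx.1 hy.1 hne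
        (hx.2.trans hy.2.symm).le
      exact ⟨u, u', w, fun _ _ _ => ⟨hu, hu', hw⟩⟩
    · exact ⟨x, x, x, fun h1 h2 h3 => absurd ⟨h1, h2, h3⟩ hxy⟩
  choose U U' W hW using hex
  obtain ⟨f, ⟨p, p', q, q'⟩, hf, hcol⟩ :=
    hR _ (fun x y => (c (U x y), c (W x y), c (U y x), c (W y x))) hC
  simp only [Prod.mk.injEq] at hcol
  have hfI : ∀ i, f i ∈ I := fun i => (Finset.mem_filter.mp (hf i)).1
  have hfC : ∀ i, c '' privateNbrs G v I (f i) = C := fun i => (Finset.mem_filter.mp (hf i)).2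
  have hne : ∀ i j, i ≠ j → f i ≠ f j := by
    intro i j hij
    rcases hij.lt_or_gt with hij | hij
    · exact (hcol i j hij).1
    · exact (hcol j i hij).1.symm
  have hw : ∀ i j, i ≠ j → _ := fun i j hij => hW (f i) (f j) (hf i) (hf j) (hne i j hij)
  have huniq : ∀ i z z', z ∈ privateNbrs G v I (f i) → z' ∈ privateNbrs G v I (f i) →
      c z = c z' → z = z' := by
    intro i z z' hz hz' hzz
    by_contra hn
    exact c.valid (h.adj_of_mem hD (hfI i) hz hz' hn) hzz
  have h01 : (0 : Fin 10) < 1 := by decide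
  have ha : ∀ i, ∃ z, z ∈ privateNbrs G v I (f i) ∧ c z = p := by
    intro i
    have : p ∈ c '' privateNbrs G v I (f 0) := ⟨_, (hw 0 1 h01.ne).1, (hcol 0 1 h01).2.1⟩
    rwa [hfC, ← hfC i] at this
  have hb : ∀ i, ∃ z, z ∈ privateNbrs G v I (f i) ∧ c z = q := by
    intro i
    have : q ∈ c '' privateNbrs G v I (f 1) := ⟨_, (hw 1 0 h01.ne').1, (hcol 0 1 h01).2.2.2.1⟩
    rwa [hfC, ← hfC i] at this
  choose a ha hap using ha
  choose b hb hbq using hb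
  have hcross : ∀ {i j z z'}, i ≠ j → z ∈ privateNbrs G v I (f i) →
      z' ∈ privateNbrs G v I (f j) → ¬ G.Adj z z' := fun hij hz hz' =>
    h.not_adj_of_mem_of_mem hD (hfI _) (hfI _) (hne _ _ hij) hz hz'
  refine not_separates_both_directions hP hD (v := v) (a := a) (b := b)
    (S := fun i j => W (f i) (f j)) (T := fun i j => W (f i) (f j)) ?_ ?_
    (fun i j hij => hcross hij (ha i) (hb j)) ?_
  · refine ⟨fun i => (ha i).1, ?_, fun i j hij => (hw i j hij.ne).2.2.2.2.2, ?_, ?_, ?_⟩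
    · intro i j
      rcases eq_or_ne i j with rfl | hij
      · exact G.loopless.irrefl _
      · exact hcross hij (ha i) (ha j)
    · intro i j hij
      obtain ⟨h1, -, -, h4, -⟩ := hw i j hij.ne
      rwa [huniq i _ _ (ha i) h1 ((hap i).trans (hcol i j hij).2.1.symm)]
    · intro i j hij
      obtain ⟨-, h2, h3, -, h5, -⟩ := hw i j hij.ne
      rwa [huniq j _ _ (ha j) h2 ((hap j).trans ((hcol i j hij).2.1.symm.trans h3))]
    · intro i j i' j' hij hij' hadj
      exact c.valid hadj ((hcol i j hij).2.2.1.trans (hcol i' j' hij').2.2.1.symm)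
  · refine ⟨fun i => (hb i).1, ?_, fun i j hij => (hw _ _ (ne_of_gt hij)).2.2.2.2.2, ?_, ?_, ?_⟩
    · intro i j
      rcases eq_or_ne i j with rfl | hij
      · exact G.loopless.irrefl _
      · exact hcross hij (hb i) (hb j)
    · intro i j hij
      obtain ⟨h1, -, -, h4, -⟩ := hw _ _ (ne_of_gt hij)
      have e := huniq _ _ _ (hb i) h1 ((hbq i).trans (hcol _ _ hij).2.2.2.1.symm)
      exact e.symm ▸ h4
    · intro i j hij
      obtain ⟨-, h2, h3, -, h5, -⟩ := hw _ _ (ne_of_gt hij)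
      have e := huniq _ _ _ (hb j) h2 ((hbq j).trans ((hcol _ _ hij).2.2.2.1.symm.trans h3))
      exact e.symm ▸ h5
    · intro i j i' j' hij hij' hadj
      exact c.valid hadj ((hcol _ _ hij).2.2.2.2.trans (hcol _ _ hij').2.2.2.2.symm)
  · by_cases hpq : p = q
    · exact Or.inl fun i => huniq i _ _ (ha i) (hb i) ((hap i).trans (hpq.trans (hbq i).symm))
    · refine Or.inr fun i => h.adj_of_mem hD (hfI i) (ha i) (hb i) fun e => hpq ?_
      rw [← hap i, ← hbq i, e]

/-- Degrees in `k`-vertex-critical (`P5`, dart)-free graphs are bounded. -/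
lemma exists_degree_le (k : ℕ) :
    ∃ d : ℕ, ∀ {V : Type*} [Fintype V] {G : SimpleGraph V} [DecidableRel G.Adj],
      IsVertexCritical G k → ¬ ContainsInduced G P5 → ¬ ContainsInduced G dart →
      ∀ v, G.degree v ≤ d := by
  classical
  obtain ⟨N, hN⟩ := exists_card_indep_nbrs_lt k
  refine ⟨k * (N + 3), fun {V _ G _} hG hP hD v => ?_⟩
  by_contra! hdeg
  obtain ⟨c⟩ := hG.colorable
  obtain ⟨p, -, hp⟩ := Finset.exists_lt_card_fiber_of_mul_lt_card_of_maps_to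
    (s := G.neighborFinset v) (t := Finset.univ) (f := c) (n := N + 3)
    (fun _ _ => Finset.mem_univ _) (by simpa using hdeg)
  obtain ⟨I, hI, hmax⟩ := Finset.exists_max_image
    (Finset.univ.filter fun I : Finset V => (∀ x ∈ I, G.Adj v x) ∧ ∀ x ∈ I, ∀ y ∈ I, ¬ G.Adj x y)
    Finset.card ⟨∅, by simp⟩
  simp only [Finset.mem_filter, Finset.mem_univ, true_and] at hI hmax
  have hcard : N + 3 < I.card := by
    refine hp.trans_le (hmax _ ⟨fun x hx => by simpa using (Finset.mem_filter.mp hx).1, ?_⟩)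
    intro x hx y hy hadj
    exact c.valid hadj ((Finset.mem_filter.mp hx).2.trans (Finset.mem_filter.mp hy).2.symm)
  have := hN hG hP hD (v := v) (I := I) ⟨hI.1, hI.2, ?_, by omega⟩
  · omega
  intro z hvz hzI
  by_contra! hno
  have := hmax (insert z I) ⟨?_, ?_⟩
  · rw [Finset.card_insert_of_notMem hzI] at this
    omega
  · exact Finset.forall_mem_insert _ _ _ |>.mpr ⟨hvz, hI.1⟩
  · intro x hx y hy
    rcases Finset.mem_insert.mp hx with hxz | hx <;> rcases Finset.mem_insert.mp hy with hyz | hy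
    · exact fun e => e.ne (hxz.trans hyz.symm)
    · exact fun e => hno y hy (hxz ▸ e.symm)
    · exact fun e => hno x hx (hyz ▸ e)
    · exact hI.2 x hx y hy

end Neighborhood

theorem finitely_many_kVertexCritical_P5_dart_free (k : ℕ) (hk : 1 ≤ k) :
    ∃ N : ℕ, ∀ (V : Type) [Fintype V] (G : SimpleGraph V),
      IsVertexCritical G k →
      ¬ ContainsInduced G P5 → ¬ ContainsInduced G dart →
      Fintype.card V ≤ N := by
  classical
  obtain ⟨d, hd⟩ := exists_degree_le k
  exact ⟨(d + 1) ^ 3, fun V _ G hG hP hD => hG.card_le_of_degree_le hP (hd hG hP hD)⟩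
end

section
/- Let G be a k-vertex-critical finite simple graph. Then there do not exist two nonempty disjoint subsets X and Y of V(G) such that: X and Y are anticomplete to each other; χ(G[X]) ≤ χ(G[Y]); and Y is complete to N(X), where N(X) is the set of vertices outside X having a neighbor in X. -/
open SimpleGraph

/-- If `X` and `Y` are disjoint, `χ(G[X]) ≤ χ(G[Y])` and `Y` is complete to `N(X)`, then a colouring
of `G - X` extends to `G`: colour `X` with the colours that appear on `Y`. -/
lemma SimpleGraph.Colorable.of_induce_compl {V : Type*} {G : SimpleGraph V} {X Y : Set V} {n : ℕ}
    (hdisj : Disjoint X Y) (hle : (G.induce X).chromaticNumber ≤ (G.induce Y).chromaticNumber)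
    (hcomp : ∀ y ∈ Y, ∀ z, z ∉ X → (∃ x ∈ X, G.Adj z x) → G.Adj y z)
    (h : (G.induce Xᶜ).Colorable n) : G.Colorable n := by
  classical
  obtain ⟨c⟩ := h
  have hY (y : Y) : (y : V) ∈ Xᶜ := hdisj.notMem_of_mem_right y.2
  let S : Set (Fin n) := Set.range fun y : Y => c ⟨y, hY y⟩
  let cY : (G.induce Y).Coloring S :=
    Coloring.mk (fun y => ⟨c ⟨y, hY y⟩, y, rfl⟩) fun {a b} hab he =>
      c.valid (v := ⟨a, hY a⟩) (w := ⟨b, hY b⟩) hab (congrArg Subtype.val he)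
  have hX : (G.induce X).Colorable (Fintype.card S) :=
    chromaticNumber_le_iff_colorable.1 (hle.trans cY.colorable.chromaticNumber_le)
  let d : (G.induce X).Coloring S := hX.toColoring le_rfl
  have hd (a b : V) (ha : a ∈ X) (hb : b ∉ X) (hab : G.Adj b a) :
      (d ⟨a, ha⟩ : Fin n) ≠ c ⟨b, hb⟩ := by
    obtain ⟨y, hy⟩ := (d ⟨a, ha⟩).2
    rw [← hy]
    exact c.valid (v := ⟨y, hY y⟩) (w := ⟨b, hb⟩) (hcomp y y.2 b hb ⟨a, ha, hab⟩)
  refine ⟨Coloring.mk (fun v => if hv : v ∈ X then (d ⟨v, hv⟩ : Fin n) else c ⟨v, hv⟩) ?_⟩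
  intro a b hab
  by_cases ha : a ∈ X <;> by_cases hb : b ∈ X <;> simp only [ha, hb, dite_true, dite_false]
  · exact fun he => d.valid (v := ⟨a, ha⟩) (w := ⟨b, hb⟩) hab (Subtype.ext he)
  · exact hd a b ha hb hab.symm
  · exact (hd b a hb ha hab).symm
  · exact c.valid (v := ⟨a, ha⟩) (w := ⟨b, hb⟩) hab

theorem no_anticomplete_pair_in_vertexCritical {V : Type} [Fintype V]
    (G : SimpleGraph V) (k : ℕ) (hG : IsVertexCritical G k) :
    ¬ ∃ X Y : Set V, X.Nonempty ∧ Y.Nonempty ∧ Disjoint X Y ∧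
      (∀ x ∈ X, ∀ y ∈ Y, ¬ G.Adj x y) ∧
      (G.induce X).chromaticNumber ≤ (G.induce Y).chromaticNumber ∧
      (∀ y ∈ Y, ∀ z, z ∉ X → (∃ x ∈ X, G.Adj z x) → G.Adj y z) := by
  rintro ⟨X, Y, ⟨x, hx⟩, -, hdisj, -, hle, hcomp⟩
  obtain ⟨m, hm⟩ := ENat.ne_top_iff_exists.1 (hG.2 x).ne_top
  have hcol : (G.induce {u | u ≠ x}).Colorable m := chromaticNumber_le_iff_colorable.1 hm.ge
  have hsub : Xᶜ ⊆ {u | u ≠ x} := fun u hu hux => hu (hux ▸ hx)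
  have hcompl : (G.induce Xᶜ).Colorable m := hcol.of_hom (induceHomOfLE G hsub).toHom
  have hGm : G.chromaticNumber ≤ m :=
    (hcompl.of_induce_compl hdisj hle hcomp).chromaticNumber_le
  have hlt := hG.2 x
  rw [← hm, ← hG.1] at hlt
  exact hGm.not_gt hlt
end

section
/- Let G be a 5-vertex-critical P5-free finite simple graph, let S be a homogeneous set of vertices of G, and let A be a connected component of the induced subgraph G[S]. Then: (i) if χ(A) = 1 then A is isomorphic to K1; (ii) if χ(A) = 2 then A is isomorphic to K2; (iii) if χ(A) = 3 then A is isomorphic to K3 or to the 5-cycle C5. -/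
open SimpleGraph

/-- `S` is a homogeneous set of `G`: every vertex outside `S` is adjacent either to
all vertices of `S` or to none of them. -/
def IsHomogeneous {V : Type*} (G : SimpleGraph V) (S : Set V) : Prop :=
  ∀ u ∉ S, (∀ s ∈ S, G.Adj u s) ∨ (∀ s ∈ S, ¬ G.Adj u s)

/-- The cycle on 5 vertices. -/
def C5 : SimpleGraph (Fin 5) := SimpleGraph.fromRel (fun a b => b = a + 1)

/-- Let `e` embed `H` into `G` so that every vertex outside the range of `e` is complete or
anticomplete to it. If `G` is not `k`-colorable but every vertex-deleted subgraph of `G` is, then a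
subgraph of `H` which needs as many colors as `H` uses all vertices of `H`. -/
theorem surjective_of_not_colorable {V U W : Type*} {G : SimpleGraph V} {H : SimpleGraph U}
    {K : SimpleGraph W} {k m : ℕ} (hG : ¬ G.Colorable k)
    (hdel : ∀ v, (G.induce {u | u ≠ v}).Colorable k) (e : H ↪g G)
    (hhom : ∀ v ∉ Set.range e, (∀ x, G.Adj v (e x)) ∨ ∀ x, ¬ G.Adj v (e x))
    (hH : H.Colorable (m + 1)) (f : K →g H) (hK : ¬ K.Colorable m) :
    Function.Surjective f := by
  classical
  intro x
  by_contra! hx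
  obtain ⟨φ⟩ := hdel (e x)
  obtain ⟨γ⟩ := hH
  have hne (w : W) : e (f w) ≠ e x := fun h => hx w (e.injective h)
  let ψ : W → Fin k := fun w => φ ⟨e (f w), hne w⟩
  have hψ {a b : W} (hab : K.Adj a b) : ψ a ≠ ψ b :=
    φ.valid (v := ⟨e (f a), hne a⟩) (w := ⟨e (f b), hne b⟩) (e.map_adj_iff.2 (f.map_adj hab))
  have hcard : m + 1 ≤ Fintype.card (Set.range ψ) := by
    by_contra! hlt
    let ψ' : K.Coloring (Set.range ψ) :=
      Coloring.mk (fun w => ⟨ψ w, w, rfl⟩) fun hab h => hψ hab (congrArg Subtype.val h)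
    exact hK (ψ'.colorable.mono (Nat.le_of_lt_succ hlt))
  obtain ⟨σ⟩ : Nonempty (Fin (m + 1) ↪ Set.range ψ) :=
    Function.Embedding.nonempty_of_card_le (by simpa using hcard)
  have hmixed {v : V} (hv : v ∉ Set.range e) {y : U} (hvy : G.Adj v (e y)) (i : Fin (m + 1)) :
      φ ⟨v, fun h => hv ⟨x, h.symm⟩⟩ ≠ (σ i : Fin k) := by
    obtain ⟨w, hw⟩ := (σ i).2
    rw [← hw]
    have hadj : G.Adj v (e (f w)) :=
      (hhom v hv).elim (fun h => h _) fun h => absurd hvy (h y)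
    exact φ.valid (v := ⟨v, fun h => hv ⟨x, h.symm⟩⟩) (w := ⟨e (f w), hne w⟩) hadj
  refine hG ⟨Coloring.mk (fun v => if h : v ∈ Set.range e then (σ (γ h.choose) : Fin k)
    else φ ⟨v, fun h' => h ⟨x, h'.symm⟩⟩) ?_⟩
  intro a b hab
  by_cases ha : a ∈ Set.range e <;> by_cases hb : b ∈ Set.range e <;>
    simp only [ha, hb, dif_pos, dif_neg, not_false_eq_true]
  · intro h
    refine γ.valid ?_ (σ.injective (Subtype.ext h))
    rwa [← e.map_adj_iff, ha.choose_spec, hb.choose_spec]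
  · rw [← ha.choose_spec] at hab
    exact (hmixed hb hab.symm _).symm
  · rw [← hb.choose_spec] at hab
    exact hmixed ha hab _
  · exact φ.valid (v := ⟨a, fun h => ha ⟨x, h.symm⟩⟩) (w := ⟨b, fun h => hb ⟨x, h.symm⟩⟩) hab

theorem SimpleGraph.Connected.exists_adj_dist_eq {V : Type*} {G : SimpleGraph V}
    (hG : G.Connected) {r u : V} {d : ℕ} (hd : G.dist r u = d + 1) :
    ∃ w, G.Adj w u ∧ G.dist r w = d := by
  obtain ⟨p, hp⟩ := hG.exists_walk_length_eq_dist u r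
  rw [dist_comm, hd] at hp
  cases p with
  | nil => simp at hp
  | @cons _ w _ h q =>
    refine ⟨w, h.symm, ?_⟩
    have hq : q.length = d := by simpa using hp
    have h₁ : G.dist w r ≤ d := hq ▸ dist_le q
    have h₂ := hG.dist_triangle (u := r) (v := w) (w := u)
    rw [dist_eq_one_iff_adj.2 h.symm] at h₂
    rw [dist_comm] at h₁
    omega

theorem containsInduced_top {V : Type*} {G : SimpleGraph V} {n : ℕ} (f : Fin n → V)
    (hf : ∀ i j, i < j → G.Adj (f i) (f j)) :
    ContainsInduced G (⊤ : SimpleGraph (Fin n)) := by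
  have hadj {i j : Fin n} (h : i ≠ j) : G.Adj (f i) (f j) :=
    h.lt_or_gt.elim (hf i j) fun h => (hf j i h).symm
  have hinj : Function.Injective f := fun i j hij => by
    by_contra h
    exact (hadj h).ne hij
  exact ⟨⟨f, hinj⟩, fun _ _ => ⟨hadj, fun h hij => h.ne (congrArg f hij)⟩⟩

theorem containsInduced_P5 {V : Type*} {G : SimpleGraph V} {a b c d e : V}
    (hab : G.Adj a b) (hbc : G.Adj b c) (hcd : G.Adj c d) (hde : G.Adj d e)
    (hac : ¬ G.Adj a c) (had : ¬ G.Adj a d) (hae : ¬ G.Adj a e) (hbd : ¬ G.Adj b d)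
    (hbe : ¬ G.Adj b e) (hce : ¬ G.Adj c e) : ContainsInduced G P5 := by
  have hadj (i j : Fin 5) : P5.Adj i j ↔ G.Adj (![a, b, c, d, e] i) (![a, b, c, d, e] j) := by
    fin_cases i <;> fin_cases j <;> simp_all [P5, pathGraph_adj, G.adj_comm]
  refine ⟨⟨![a, b, c, d, e], fun i j hij => ?_⟩, hadj⟩
  have htwin (l : Fin 5) : P5.Adj i l ↔ P5.Adj j l := by rw [hadj, hadj, hij]
  revert htwin
  simp only [P5, pathGraph_adj]
  clear hij
  revert i j
  decide

theorem containsInduced_C5 {V : Type*} {G : SimpleGraph V} {a b c d e : V}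
    (hab : G.Adj a b) (hbc : G.Adj b c) (hcd : G.Adj c d) (hde : G.Adj d e)
    (hea : G.Adj e a) (hac : ¬ G.Adj a c) (had : ¬ G.Adj a d) (hbd : ¬ G.Adj b d)
    (hbe : ¬ G.Adj b e) (hce : ¬ G.Adj c e) : ContainsInduced G C5 := by
  have hadj (i j : Fin 5) : C5.Adj i j ↔ G.Adj (![a, b, c, d, e] i) (![a, b, c, d, e] j) := by
    fin_cases i <;> fin_cases j <;> simp_all [C5, G.adj_comm]
  refine ⟨⟨![a, b, c, d, e], fun i j hij => ?_⟩, hadj⟩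
  have htwin (l : Fin 5) : C5.Adj i l ↔ C5.Adj j l := by rw [hadj, hadj, hij]
  revert htwin
  simp only [C5, fromRel_adj]
  clear hij
  revert i j
  decide

theorem not_colorable_two_C5 : ¬ C5.Colorable 2 := by
  rintro ⟨φ⟩
  have h₀ := φ.valid (v := 0) (w := 1) (by simp [C5])
  have h₁ := φ.valid (v := 1) (w := 2) (by simp [C5])
  have h₂ := φ.valid (v := 2) (w := 3) (by simp [C5])
  have h₃ := φ.valid (v := 3) (w := 4) (by simp [C5])
  have h₄ := φ.valid (v := 4) (w := 0) (by simp [C5])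
  omega

theorem colorable_two_of_connected {V : Type*} {G : SimpleGraph V} (hG : G.Connected)
    (hP5 : ¬ ContainsInduced G P5) (hK3 : ¬ ContainsInduced G (⊤ : SimpleGraph (Fin 3)))
    (hC5 : ¬ ContainsInduced G C5) : G.Colorable 2 := by
  obtain ⟨r⟩ := hG.nonempty
  have hdist {a b : V} (hab : G.Adj a b) : G.dist r b ≤ G.dist r a + 1 := by
    simpa [dist_eq_one_iff_adj.2 hab] using hG.dist_triangle (u := r) (v := a) (w := b)
  have hfar {a b : V} (h : G.dist r a + 1 < G.dist r b) : ¬ G.Adj a b :=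
    fun hab => (hdist hab).not_gt h
  have htri {a b c : V} (hab : G.Adj a b) (hac : G.Adj a c) : ¬ G.Adj b c :=
    fun hbc => by
    refine hK3 (containsInduced_top ![a, b, c] fun i j hij => ?_)
    fin_cases i <;> fin_cases j <;> first | assumption | simp at hij
  refine ⟨Coloring.mk (fun v => Fin.ofNat 2 (G.dist r v)) ?_⟩
  intro u v huv heq
  have hd : G.dist r u = G.dist r v := by
    have h₁ := hdist huv
    have h₂ := hdist huv.symm
    have h₃ : G.dist r u % 2 = G.dist r v % 2 := congrArg Fin.val heq
    omega
  obtain hu | ⟨d, hu⟩ : G.dist r u = 0 ∨ ∃ d, G.dist r u = d + 1 := by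
    cases G.dist r u <;> simp
  · exact huv.ne ((hG.dist_eq_zero_iff.1 hu).symm.trans (hG.dist_eq_zero_iff.1 (hd ▸ hu)))
  obtain ⟨a, hau, ha⟩ := hG.exists_adj_dist_eq hu
  obtain ⟨b, hbv, hb⟩ := hG.exists_adj_dist_eq (hd ▸ hu)
  have hav : ¬ G.Adj a v := fun h => htri hau h huv
  have hbu : ¬ G.Adj b u := fun h => htri h hbv huv
  obtain _ | _ | d := d
  · obtain rfl := hG.dist_eq_zero_iff.1 ha
    obtain rfl := hG.dist_eq_zero_iff.1 hb
    exact hav hbv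
  · have hra : G.Adj r a := dist_eq_one_iff_adj.1 ha
    have hrb : G.Adj r b := dist_eq_one_iff_adj.1 hb
    have hru : ¬ G.Adj r u := hfar (by simp [hu])
    have hrv : ¬ G.Adj r v := hfar (by simp [← hd, hu])
    exact hC5 (containsInduced_C5 hra hau huv hbv.symm hrb.symm hru hrv hav (htri hra hrb)
      fun h => hbu h.symm)
  · obtain ⟨p, hpa, hp⟩ := hG.exists_adj_dist_eq ha
    obtain ⟨q, hqp, hq⟩ := hG.exists_adj_dist_eq hp
    exact hP5 (containsInduced_P5 hqp hpa hau huv (hfar (by omega)) (hfar (by omega))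
      (hfar (by omega)) (hfar (by omega)) (hfar (by omega)) hav)

theorem homogeneous_components_in_5_vertex_critical {V : Type} [Fintype V]
    (G : SimpleGraph V) (hcrit : IsVertexCritical G 5)
    (hP5 : ¬ ContainsInduced G P5)
    (S : Set V) (hS : IsHomogeneous G S)
    (c : (G.induce S).ConnectedComponent) :
    (((G.induce S).induce c.supp).chromaticNumber = 1 →
      Nonempty ((G.induce S).induce c.supp ≃g (⊤ : SimpleGraph (Fin 1)))) ∧
    (((G.induce S).induce c.supp).chromaticNumber = 2 →
      Nonempty ((G.induce S).induce c.supp ≃g (⊤ : SimpleGraph (Fin 2)))) ∧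
    (((G.induce S).induce c.supp).chromaticNumber = 3 →
      (Nonempty ((G.induce S).induce c.supp ≃g (⊤ : SimpleGraph (Fin 3))) ∨
       Nonempty ((G.induce S).induce c.supp ≃g C5))) := by
  set H := (G.induce S).induce c.supp
  let e : H ↪g G := (Embedding.induce c.supp).trans (Embedding.induce S)
  have hhom : ∀ v ∉ Set.range e, (∀ x, G.Adj v (e x)) ∨ ∀ x, ¬ G.Adj v (e x) := by
    intro v hv
    by_cases hvS : v ∈ S
    · refine .inr fun x hvx => hv ⟨⟨⟨v, hvS⟩, ?_⟩, rfl⟩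
      exact c.mem_supp_of_adj_mem_supp x.2 (show (G.induce S).Adj x.1 ⟨v, hvS⟩ from hvx.symm)
    · exact (hS v hvS).imp (fun h x => h _ x.1.2) fun h x => h _ x.1.2
  have hG : ¬ G.Colorable 4 := fun h => by
    have := h.chromaticNumber_le
    rw [hcrit.1] at this
    exact absurd this (by decide)
  have hdel (v : V) : (G.induce {u | u ≠ v}).Colorable 4 :=
    chromaticNumber_le_iff_colorable.1 (Order.le_of_lt_add_one (hcrit.2 v))
  have hiso {n m : ℕ} {K : SimpleGraph (Fin n)} (hcol : H.Colorable (m + 1))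
      (hK : ¬ K.Colorable m) : ContainsInduced H K → Nonempty (H ≃g K) := by
    rintro ⟨f, hf⟩
    have hsurj := surjective_of_not_colorable hG hdel e hhom hcol ⟨f, (hf _ _).1⟩ hK
    exact ⟨.symm ⟨Equiv.ofBijective f ⟨f.injective, hsurj⟩, (hf _ _).symm⟩⟩
  have htop (m : ℕ) : ¬ (⊤ : SimpleGraph (Fin (m + 1))).Colorable m := fun h => by
    have := h.chromaticNumber_le
    rw [chromaticNumber_top, Fintype.card_fin, Nat.cast_le] at this
    omega
  have hconn : H.Connected := c.connected_toSimpleGraph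
  have hcolorable {n : ℕ} (h : H.chromaticNumber = n) : H.Colorable n :=
    chromaticNumber_le_iff_colorable.1 h.le
  have hnot {n m : ℕ} (h : H.chromaticNumber = n) (hm : m < n) : ¬ H.Colorable m := fun h' => by
    have := h'.chromaticNumber_le
    rw [h] at this
    exact absurd (Nat.cast_le.1 this) hm.not_ge
  refine ⟨fun h => hiso (hcolorable h) (htop 0) ?_, fun h => hiso (hcolorable h) (htop 1) ?_,
    fun h => ?_⟩
  · obtain ⟨x⟩ := hconn.nonempty
    exact containsInduced_top (fun _ => x) fun i j hij => by omega
  · obtain ⟨a, b, hab⟩ : ∃ a b, H.Adj a b := by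
      by_contra! hno
      exact hnot h one_lt_two ⟨Coloring.mk (fun _ => 0) fun hab => absurd hab (hno _ _)⟩
    refine containsInduced_top ![a, b] fun i j hij => ?_
    fin_cases i <;> fin_cases j <;> first | assumption | simp at hij
  · by_contra hno
    refine hnot h (show 2 < 3 by decide) (colorable_two_of_connected hconn ?_
      (fun hK => hno (.inl (hiso (hcolorable h) (htop 2) hK)))
      (fun hC => hno (.inr (hiso (hcolorable h) not_colorable_two_C5 hC))))
    rintro ⟨f, hf⟩
    exact hP5 ⟨f.trans e.toEmbedding, fun a b => (hf a b).trans e.map_adj_iff.symm⟩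
end

section
/- Let G be a k-vertex-critical finite simple graph and let S be a homogeneous set of vertices of G. Then for every connected component A of the induced subgraph G[S], if χ(A) = m with m < k, then A is an m-vertex-critical graph. -/
open SimpleGraph

/-- An induced subgraph on a homogeneous set of a vertex-critical graph is vertex-critical. -/
theorem IsVertexCritical.of_embedding {V W : Type*} [Finite W] {G : SimpleGraph V}
    {H : SimpleGraph W} {k m : ℕ} (hG : IsVertexCritical G k) (f : H ↪g G)
    (hf : IsHomogeneous G (Set.range f)) (hH : H.chromaticNumber = m) :
    IsVertexCritical H m := by
  classical
  have := Fintype.ofFinite W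
  refine ⟨hH, fun x => ?_⟩
  by_contra! hx
  have hlt := hG.2 (f x)
  obtain ⟨n, hn⟩ := ENat.ne_top_iff_exists.mp hlt.ne_top
  obtain ⟨φ⟩ := chromaticNumber_le_iff_colorable.mp hn.ge
  have hne : ∀ y : {y | y ≠ x}, f y ∈ {u | u ≠ f x} := fun y h => y.2 (f.injective h)
  let φ' : {y | y ≠ x} → Fin n := fun y => φ ⟨f y, hne y⟩
  let T : Finset (Fin n) := Finset.univ.image φ'
  have hφ' : ∀ y, φ' y ∈ T := fun y => Finset.mem_image_of_mem _ (Finset.mem_univ y)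
  have hT : (H.induce {y | y ≠ x}).Colorable T.card := by
    let C : (H.induce {y | y ≠ x}).Coloring T :=
      Coloring.mk (fun y => ⟨φ' y, hφ' y⟩) fun {a b} hab h =>
        φ.valid (v := ⟨f a, hne a⟩) (w := ⟨f b, hne b⟩)
          (f.map_adj_iff.mpr hab) (congrArg Subtype.val h)
    simpa using C.colorable
  have hmT : m ≤ T.card := by exact_mod_cast hx.trans hT.chromaticNumber_le
  have hHT : H.Colorable T.card := (chromaticNumber_le_iff_colorable.mp hH.le).mono hmT
  let ρ : H.Coloring T := hHT.toColoring (by simp)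
  let ψ : V → Fin n := fun v =>
    if h : ∃ y, f y = v then ρ h.choose else φ ⟨v, fun e => h ⟨x, e.symm⟩⟩
  have hψ : ∀ y, ψ (f y) = ρ y := fun y => by
    have h : ∃ z, f z = f y := ⟨y, rfl⟩
    simp only [ψ, dif_pos h, f.injective h.choose_spec]
  have hψ' : ∀ v (h : ¬ ∃ y, f y = v), ψ v = φ ⟨v, fun e => h ⟨x, e.symm⟩⟩ :=
    fun v h => dif_neg h
  have hcross : ∀ y v, (¬ ∃ z, f z = v) → G.Adj v (f y) → ψ v ≠ ψ (f y) := by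
    intro y v hv hadj heq
    obtain ⟨z, -, hz⟩ := Finset.mem_image.mp (ρ y).2
    rw [hψ, hψ' v hv, ← hz] at heq
    rcases hf v hv with h | h
    · exact φ.valid (v := ⟨v, _⟩) (w := ⟨f z, hne z⟩) (h _ ⟨z, rfl⟩) heq
    · exact h _ ⟨y, rfl⟩ hadj
  have hcol : G.Colorable n := by
    refine ⟨Coloring.mk ψ fun {a b} hab => ?_⟩
    by_cases ha : ∃ y, f y = a
    · obtain ⟨y, rfl⟩ := ha
      by_cases hb : ∃ z, f z = b
      · obtain ⟨z, rfl⟩ := hb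
        rw [hψ, hψ]
        exact fun h => ρ.valid (f.map_adj_iff.mp hab) (Subtype.ext h)
      · exact (hcross y b hb hab.symm).symm
    · by_cases hb : ∃ z, f z = b
      · obtain ⟨z, rfl⟩ := hb
        exact hcross z a ha hab
      · rw [hψ' a ha, hψ' b hb]
        exact φ.valid hab
  have hle := hcol.chromaticNumber_le
  rw [hG.1] at hle
  rw [← hn] at hlt
  exact absurd hlt hle.not_gt

/-- The connected components of the graph induced on a homogeneous set are homogeneous. -/
theorem IsHomogeneous.component {V : Type*} {G : SimpleGraph V} {S : Set V}
    (hS : IsHomogeneous G S) (c : (G.induce S).ConnectedComponent) :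
    IsHomogeneous G (Subtype.val '' c.supp) := by
  intro u hu
  by_cases huS : u ∈ S
  · right
    rintro _ ⟨s, hs, rfl⟩ hadj
    refine hu ⟨⟨u, huS⟩, ?_, rfl⟩
    have hadj' : (G.induce S).Adj s ⟨u, huS⟩ := hadj.symm
    exact (ConnectedComponent.connectedComponentMk_eq_of_adj hadj').symm.trans hs
  · rcases hS u huS with h | h
    · exact .inl fun _ ⟨s, _, hs⟩ => hs ▸ h s s.2
    · exact .inr fun _ ⟨s, _, hs⟩ => hs ▸ h s s.2

theorem homogeneous_component_is_vertexCritical {V : Type} [Fintype V]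
    (G : SimpleGraph V) (k : ℕ) (hcrit : IsVertexCritical G k)
    (S : Set V) (hS : IsHomogeneous G S)
    (c : (G.induce S).ConnectedComponent) (m : ℕ) (hm : m < k)
    (hchi : ((G.induce S).induce c.supp).chromaticNumber = m) :
    IsVertexCritical ((G.induce S).induce c.supp) m := by
  let f : (G.induce S).induce c.supp ↪g G :=
    (Embedding.induce S).comp (Embedding.induce c.supp)
  refine hcrit.of_embedding f ?_ hchi
  have hf : Set.range f = Subtype.val '' c.supp := by
    ext v
    exact ⟨fun ⟨y, hy⟩ => ⟨y, y.2, hy⟩, fun ⟨y, hyc, hy⟩ => ⟨⟨y, hyc⟩, hy⟩⟩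
  rw [hf]
  exact hS.component c
end

section
/- Every 4-vertex-critical P5-free finite simple graph has at most 13 vertices. -/
open SimpleGraph

namespace P5Critical

/-! ### A checker for exhaustive generation

Finite sets of naturals are encoded as bit masks. The combinators below reduce in a single
recursor step, which keeps the evaluation of the checker by the kernel fast. -/

/-- Case distinction on a Boolean. -/
def sel {α : Type} (b : Bool) (x y : α) : α := Bool.rec y x b

/-- Right fold over a list. -/
def foldList {α β : Type} (l : List α) (f : α → β → β) (z : β) : β :=
  List.rec z (fun a _ r => f a r) l

/-- Every entry of the list satisfies `f`. -/
def allList {α : Type} (l : List α) (f : α → Bool) : Bool :=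
  foldList l (fun a r => sel (f a) r false) true

/-- The masks `a` and `b` are disjoint. -/
def disj (a b : ℕ) : Bool := Nat.beq (Nat.land a b) 0

/-- The pattern `(M, R)` does not occur in `y`: the mask `y` does not meet `M` exactly in `R`. -/
def misses (y : ℕ) (q : ℕ × ℕ) : Bool := sel (Nat.beq (Nat.land y q.1) q.2) false true

/-- Prepend the pattern of the masks that contain `R` and are disjoint from `N`. -/
def addPattern (R N : ℕ) (z : List (ℕ × ℕ)) : List (ℕ × ℕ) := (Nat.lor R N, R) :: z

/-- Attachments that complete an induced `P5` through a vertex with bit `w` and neighbourhood mask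
`t`. The list `vs` holds the older vertices as pairs of a bit and a neighbourhood mask. -/
def patterns (w t : ℕ) (vs : List (ℕ × ℕ)) : List (ℕ × ℕ) :=
  foldList vs (fun a z => sel (disj a.1 t)
    (foldList vs (fun b z => sel (disj b.1 t) (sel (disj b.1 a.2) z
      (foldList vs (fun c z => sel (Nat.beq c.1 a.1) z (sel (disj c.1 t) (sel (disj c.1 b.2) z
        (sel (disj c.1 a.2)
          (addPattern (Nat.lor w a.1) (Nat.lor b.1 c.1) z) z)) z)) z)) z) z)
    (foldList vs (fun b z => sel (disj b.1 a.2)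
      (sel (disj b.1 t)
        (foldList vs (fun c z => sel (disj c.1 a.2) (sel (disj c.1 t) (sel (disj c.1 b.2) z
          (addPattern (Nat.lor w b.1) (Nat.lor a.1 c.1)
            (addPattern (Nat.lor a.1 b.1) (Nat.lor w c.1) z))) z) z) z)
        (sel (Nat.beq b.1 a.1) z
          (foldList vs (fun c z => sel (disj c.1 a.2) (sel (disj c.1 t) (sel (disj c.1 b.2)
            (addPattern (Nat.lor c.1 a.1) (Nat.lor w b.1) z) z) z) z) z)))
      (sel (disj b.1 t)
        (foldList vs (fun c z => sel (disj c.1 a.2)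
          (sel (disj c.1 b.2)
            (sel (disj c.1 t)
              (addPattern (Nat.lor c.1 w) (Nat.lor a.1 b.1)
                (addPattern (Nat.lor c.1 b.1) (Nat.lor a.1 w) z))
              (addPattern c.1 (Nat.lor w (Nat.lor a.1 b.1))
                (addPattern b.1 (Nat.lor c.1 (Nat.lor w a.1)) z)))
            (sel (disj c.1 t)
              (addPattern w (Nat.lor a.1 (Nat.lor b.1 c.1))
                (addPattern c.1 (Nat.lor a.1 (Nat.lor b.1 w)) z))
              z)) z) z)
        z)) z)) []

/-- The list of vertices after adding a vertex with bit `w` and neighbourhood mask `t`. -/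
def addVertex (w t : ℕ) (vs : List (ℕ × ℕ)) : List (ℕ × ℕ) :=
  foldList vs (fun a z => (a.1, sel (disj a.1 t) a.2 (Nat.lor a.2 w)) :: z) [(w, t)]

/-- The 3-colourings, as triples of masks, after adding a vertex. -/
def addColor (w t : ℕ) (C : List (ℕ × ℕ × ℕ)) : List (ℕ × ℕ × ℕ) :=
  foldList C (fun c z =>
    (fun z => sel (disj c.1 t) ((Nat.lor c.1 w, c.2.1, c.2.2) :: z) z)
    ((fun z => sel (disj c.2.1 t) ((c.1, Nat.lor c.2.1 w, c.2.2) :: z) z)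
    (sel (disj c.2.2 t) ((c.1, c.2.1, Nat.lor c.2.2 w) :: z) z))) []

/-- Some colouring in `C` extends to a vertex with neighbourhood mask `y`. -/
def colorExtends (C : List (ℕ × ℕ × ℕ)) (y : ℕ) : Bool :=
  foldList C (fun c z =>
    sel (disj c.1 y) true (sel (disj c.2.1 y) true (sel (disj c.2.2 y) true z))) false

/-- The mask `y` avoids all patterns in `P` and admits an extension of a colouring in `C`. -/
def admissible (P : List (ℕ × ℕ)) (C : List (ℕ × ℕ × ℕ)) (y : ℕ) : Bool :=
  sel (allList P (misses y)) (colorExtends C y) false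

/-- The possible neighbourhood masks of further vertices after adding a vertex with bit `w`. -/
def addTypes (w : ℕ) (T : List ℕ) (P : List (ℕ × ℕ)) (C : List (ℕ × ℕ × ℕ)) : List ℕ :=
  foldList T (fun y z =>
    (fun z => sel (admissible P C y) (y :: z) z)
    (sel (admissible P C (Nat.lor y w)) (Nat.lor y w :: z) z)) []

/-- The map that sends `p.1` to `p.2` for each entry `p` of the list and fixes all else. -/
def moveMap (l : List (ℕ × ℕ)) (i : ℕ) : ℕ :=
  foldList l (fun p r => sel (Nat.beq p.1 i) p.2 r) i

/-- The neighbourhood mask of the vertex with index `i`. -/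
def row (vs : List (ℕ × ℕ)) (i : ℕ) : ℕ := (vs.getD i (0, 0)).2

/-- The map `φ` is a non-surjective endomorphism of the graph on `n` vertices that remains an
endomorphism after adding vertices with neighbourhood masks in `T`. -/
def foldable (n : ℕ) (vs : List (ℕ × ℕ)) (T : List ℕ) (φ : ℕ → ℕ) : Bool :=
  ((List.range n).any fun k => (List.range n).all fun i => !Nat.beq (φ i) k) &&
  (List.range n).all fun i => Nat.beq (φ i) i || (Nat.blt (φ i) n &&
    ((List.range n).all fun j =>
      disj (Nat.pow 2 j) (row vs i) || !disj (Nat.pow 2 (φ j)) (row vs (φ i))) &&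
    T.all fun t => disj (Nat.pow 2 i) t || !disj (Nat.pow 2 (φ i)) t)

/-- All neighbours of the vertex `p` are among `a` and `b`, also after adding vertices with
neighbourhood masks in `T`. -/
def lowDegree (n : ℕ) (vs : List (ℕ × ℕ)) (T : List ℕ) (p a b : ℕ) : Bool :=
  Nat.blt p n &&
  ((List.range n).all fun i => disj (Nat.pow 2 i) (row vs p) || Nat.beq i a || Nat.beq i b) &&
  T.all fun t => disj (Nat.pow 2 p) t

/-- A certificate that an induced subgraph does not occur in a large critical graph. -/
inductive Certificate where
  /-- Either some vertex has neighbourhood mask `t`, or none has. -/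
  | branch (t : ℕ) (present absent : Certificate)
  /-- The graph maps homomorphically to a proper subgraph. -/
  | fold (l : List (ℕ × ℕ))
  /-- The vertex `p` has no neighbours but `a` and `b`. -/
  | low (p a b : ℕ)

/-- Check a certificate for the graph with vertex list `vs` on `n` vertices and 3-colourings `C`,
where all further vertices have neighbourhood masks in `T`. -/
def check : Certificate → ℕ → List (ℕ × ℕ) → List ℕ → List (ℕ × ℕ × ℕ) → Bool
  | .branch t present absent, n, vs, T, C =>
    Nat.blt n 12 &&
      (check present (n + 1) (addVertex (Nat.pow 2 n) t vs)
        (addTypes (Nat.pow 2 n) T (patterns (Nat.pow 2 n) t vs) (addColor (Nat.pow 2 n) t C))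
        (addColor (Nat.pow 2 n) t C) &&
      check absent n vs (foldList T (fun y z => sel (Nat.beq y t) z (y :: z)) []) C)
  | .fold l, n, vs, T, _ => foldable n vs T (moveMap l)
  | .low p a b, n, vs, T, _ => lowDegree n vs T p a b

/-! ### Semantics of masks and combinators -/

section Combinators

variable {α β : Type}

@[simp] lemma sel_true (x y : α) : sel true x y = x := rfl

@[simp] lemma sel_false (x y : α) : sel false x y = y := rfl

lemma sel_induction {P : α → Prop} {b : Bool} {x y : α} (hx : b = true → P x)
    (hy : b = false → P y) : P (sel b x y) := by
  cases b
  · exact hy rfl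
  · exact hx rfl

lemma foldList_induction {P : β → Prop} {l : List α} {f : α → β → β} {z : β} (hz : P z)
    (hf : ∀ a ∈ l, ∀ r, P r → P (f a r)) : P (foldList l f z) := by
  induction l with
  | nil => exact hz
  | cons a l ih =>
    exact hf a (by simp) _ (ih fun b hb => hf b (by simp [hb]))

lemma foldList_of_mem {P : β → Prop} {l : List α} {f : α → β → β} {z : β} {a : α} (ha : a ∈ l)
    (hfa : ∀ r, P (f a r)) (hf : ∀ b r, P r → P (f b r)) : P (foldList l f z) := by
  induction l with
  | nil => simp at ha
  | cons b l ih =>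
    rcases List.mem_cons.1 ha with rfl | h
    · exact hfa _
    · exact hf _ _ (ih h)

lemma foldList_cons (l : List α) (f : α → β) (z : List β) :
    foldList l (fun a r => f a :: r) z = l.map f ++ z := by
  induction l with
  | nil => rfl
  | cons a l ih => exact congrArg (f a :: ·) ih

lemma allList_of_forall {l : List α} {f : α → Bool} (h : ∀ a ∈ l, f a = true) :
    allList l f = true :=
  foldList_induction (P := fun r => r = true) rfl fun a ha r hr => by simp [h a ha, hr]

lemma mem_sel_cons {a b : α} {c : Bool} {l : List α} (h : a ∈ l) : a ∈ sel c (b :: l) l := by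
  cases c <;> simp [h]

end Combinators

lemma disj_iff {a b : ℕ} :
    disj a b = true ↔ ∀ i, ¬(a.testBit i = true ∧ b.testBit i = true) := by
  rw [disj, Nat.beq_eq]
  change a &&& b = 0 ↔ _
  constructor
  · intro h i
    have := congrArg (fun m => m.testBit i) h
    simpa using this
  · intro h
    refine Nat.eq_of_testBit_eq fun i => ?_
    simpa using h i

lemma disj_pow {i b : ℕ} : disj (Nat.pow 2 i) b = true ↔ b.testBit i = false := by
  rw [disj_iff]
  change (∀ j, ¬((2 ^ i : ℕ).testBit j = true ∧ _)) ↔ _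
  simp [Nat.testBit_two_pow]

open Classical in
/-- The mask of the set of all `i < n` that satisfy `p`. -/
noncomputable def mask (p : ℕ → Prop) : ℕ → ℕ
  | 0 => 0
  | n + 1 => if p n then Nat.lor (mask p n) (Nat.pow 2 n) else mask p n

lemma mask_succ_of_pos {p : ℕ → Prop} {n : ℕ} (h : p n) :
    mask p (n + 1) = Nat.lor (mask p n) (Nat.pow 2 n) := if_pos h

lemma mask_succ_of_neg {p : ℕ → Prop} {n : ℕ} (h : ¬ p n) :
    mask p (n + 1) = mask p n := if_neg h

lemma testBit_lor (a b i : ℕ) : (Nat.lor a b).testBit i = (a.testBit i || b.testBit i) :=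
  Nat.testBit_or a b i

lemma testBit_pow (i j : ℕ) : (Nat.pow 2 i).testBit j = decide (i = j) :=
  Nat.testBit_two_pow

lemma testBit_mask {p : ℕ → Prop} {n i : ℕ} : (mask p n).testBit i = true ↔ i < n ∧ p i := by
  induction n with
  | zero => simp [mask]
  | succ n ih =>
    by_cases h : p n
    · rw [mask_succ_of_pos h, testBit_lor, testBit_pow, Bool.or_eq_true, ih, decide_eq_true_iff]
      grind
    · rw [mask_succ_of_neg h, ih]
      grind

lemma mask_congr {p q : ℕ → Prop} {n : ℕ} (h : ∀ i < n, p i ↔ q i) : mask p n = mask q n := by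
  refine Nat.eq_of_testBit_eq fun i => Bool.eq_iff_iff.2 ?_
  rw [testBit_mask, testBit_mask]
  exact and_congr_right fun hi => h i hi

lemma disj_pow_mask {p : ℕ → Prop} {n i : ℕ} (hi : i < n) :
    disj (Nat.pow 2 i) (mask p n) = true ↔ ¬ p i := by
  rw [disj_pow, ← Bool.not_eq_true, testBit_mask]
  tauto

lemma disj_pow_mask_false {p : ℕ → Prop} {n i : ℕ} (hi : i < n) :
    disj (Nat.pow 2 i) (mask p n) = false ↔ p i := by
  rw [← Bool.not_eq_true, disj_pow_mask hi, not_not]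

/-! ### Soundness of the checker -/

section Soundness

variable {V : Type} (G : SimpleGraph V)

/-- The mask of the neighbours of `x` among `f 0, …, f (n - 1)`. -/
noncomputable def nbrs (f : ℕ → V) (n : ℕ) (x : V) : ℕ := mask (fun i => G.Adj (f i) x) n

/-- The list of bits and neighbourhood masks of `f 0, …, f (n - 1)`. -/
noncomputable def verts (f : ℕ → V) (n : ℕ) : List (ℕ × ℕ) :=
  (List.range n).map fun i => (Nat.pow 2 i, nbrs G f n (f i))

/-- No five vertices form an induced path. -/
def NoInducedP5 : Prop :=
  ∀ a b c d e, G.Adj a b → G.Adj b c → G.Adj c d → G.Adj d e → ¬ G.Adj a c → ¬ G.Adj a d →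
    ¬ G.Adj a e → ¬ G.Adj b d → ¬ G.Adj b e → ¬ G.Adj c e → False

/-- A proper colouring of the graph induced on `s`. -/
def ProperOn (s : Set V) (c : V → Fin 3) : Prop :=
  ∀ a ∈ s, ∀ b ∈ s, G.Adj a b → c a ≠ c b

/-- The three colour classes of `c` among `f 0, …, f (n - 1)`. -/
noncomputable def classes (f : ℕ → V) (n : ℕ) (c : V → Fin 3) : ℕ × ℕ × ℕ :=
  (mask (fun i => c (f i) = 0) n, mask (fun i => c (f i) = 1) n, mask (fun i => c (f i) = 2) n)

variable {G}

lemma mem_verts {f : ℕ → V} {n : ℕ} {a : ℕ × ℕ} (h : a ∈ verts G f n) :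
    ∃ i < n, a = (Nat.pow 2 i, nbrs G f n (f i)) := by
  obtain ⟨i, hi, rfl⟩ := List.mem_map.1 h
  exact ⟨i, List.mem_range.1 hi, rfl⟩

lemma row_verts {f : ℕ → V} {n i : ℕ} (hi : i < n) : row (verts G f n) i = nbrs G f n (f i) := by
  simp [row, verts, hi]

/-- The pattern `q` occurs in no neighbourhood. -/
def Avoids (G : SimpleGraph V) (f : ℕ → V) (n : ℕ) (z : List (ℕ × ℕ)) : Prop :=
  ∀ q ∈ z, ∀ x, misses (nbrs G f n x) q = true

lemma avoids_addPattern {f : ℕ → V} {n R N : ℕ} {z : List (ℕ × ℕ)} (hz : Avoids G f n z)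
    (h : ∀ x, (∀ i, (i < n ∧ G.Adj (f i) x) ∧ (R.testBit i = true ∨ N.testBit i = true) ↔
      R.testBit i = true) → False) :
    Avoids G f n (addPattern R N z) := by
  intro q hq x
  rcases List.mem_cons.1 hq with rfl | hq
  · refine sel_induction (P := fun b => b = true) (fun hb => (h x fun i => ?_).elim) fun _ => rfl
    have := congrArg (fun m => m.testBit i) (Nat.beq_eq.mp hb)
    change (nbrs G f n x &&& Nat.lor R N).testBit i = R.testBit i at this
    conv_rhs => rw [← this]
    rw [Nat.testBit_and, Bool.and_eq_true, testBit_lor, Bool.or_eq_true, nbrs,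
      testBit_mask]
  · exact hz q hq x

lemma avoids_addPattern_of_path {f : ℕ → V} {n i j k R N : ℕ} {z : List (ℕ × ℕ)}
    (hG : NoInducedP5 G) (hz : Avoids G f n z)
    (h : ∀ x, (∀ m ∈ [i, j, k, n - 1], (m < n ∧ G.Adj (f m) x) ∧
      (R.testBit m = true ∨ N.testBit m = true) ↔ R.testBit m = true) →
      ∃ a b c d e, (G.Adj a b ∧ G.Adj b c ∧ G.Adj c d ∧ G.Adj d e) ∧ ¬ G.Adj a c ∧ ¬ G.Adj a d ∧
        ¬ G.Adj a e ∧ ¬ G.Adj b d ∧ ¬ G.Adj b e ∧ ¬ G.Adj c e) :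
    Avoids G f n (addPattern R N z) := by
  refine avoids_addPattern hz fun x hx => ?_
  obtain ⟨a, b, c, d, e, ⟨hab, hbc, hcd, hde⟩, hac, had, hae, hbd, hbe, hce⟩ := h x fun m _ => hx m
  exact hG a b c d e hab hbc hcd hde hac had hae hbd hbe hce

lemma avoids_patterns (hG : NoInducedP5 G) {f : ℕ → V} {n : ℕ} :
    Avoids G f (n + 1) (patterns (Nat.pow 2 n) (nbrs G f n (f n)) (verts G f n)) := by
  have symm : ∀ u v, G.Adj u v → G.Adj v u := fun _ _ h => h.symm
  have irr : ∀ u, ¬ G.Adj u u := fun _ => G.irrefl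
  refine foldList_induction (by simp [Avoids]) fun a ha r hr => ?_
  obtain ⟨i, hi, rfl⟩ := mem_verts ha
  refine sel_induction (fun hwa => ?_) fun hwa => ?_ <;>
  refine foldList_induction hr fun b hb r hr => ?_ <;>
  obtain ⟨j, hj, rfl⟩ := mem_verts hb
  · refine sel_induction (fun hwb => sel_induction (fun hab => hr) fun hab => ?_) fun hwb => hr
    refine foldList_induction hr fun c hc r hr => ?_
    obtain ⟨k, hk, rfl⟩ := mem_verts hc
    refine sel_induction (fun hca => hr) fun hca => sel_induction (fun hwc => sel_induction
      (fun hbc => hr) fun hbc => sel_induction (fun hac => ?_) fun hac => hr) fun hwc => hr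
    have hki : k ≠ i := by rintro rfl; simp at hca
    simp only [nbrs, disj_pow_mask, disj_pow_mask_false, hi, hj, hk] at hwa hwb hab hwc hbc hac
    refine avoids_addPattern_of_path (i := i) (j := j) (k := k) hG hr fun x h => ?_
    simp only [List.forall_mem_cons, testBit_lor, testBit_pow, Bool.or_eq_true,
      decide_eq_true_iff, Nat.add_sub_cancel] at h
    exact ⟨f n, x, f i, f j, f k, by grind⟩
  · refine sel_induction (fun hab => sel_induction (fun hwb => ?_) fun hwb =>
      sel_induction (fun hba => hr) fun hba => ?_) fun hab => sel_induction (fun hwb => ?_) fun _ => hr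
    · refine foldList_induction hr fun c hc r hr => ?_
      obtain ⟨k, hk, rfl⟩ := mem_verts hc
      refine sel_induction (fun hac => sel_induction (fun hwc => sel_induction
        (fun hbc => hr) fun hbc => ?_) fun hwc => hr) fun hac => hr
      simp only [nbrs, disj_pow_mask, disj_pow_mask_false, hi, hj, hk] at hwa hwb hab hwc hbc hac
      refine avoids_addPattern_of_path (i := i) (j := j) (k := k) hG
        (avoids_addPattern_of_path (i := i) (j := j) (k := k) hG hr fun x h => ?_) fun x h => ?_ <;>
      simp only [List.forall_mem_cons, testBit_lor, testBit_pow, Bool.or_eq_true,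
        decide_eq_true_iff, Nat.add_sub_cancel] at h
      · exact ⟨f n, f i, x, f j, f k, by grind⟩
      · exact ⟨f i, f n, x, f j, f k, by grind⟩
    · have hji : j ≠ i := by rintro rfl; simp at hba
      refine foldList_induction hr fun c hc r hr => ?_
      obtain ⟨k, hk, rfl⟩ := mem_verts hc
      refine sel_induction (fun hac => sel_induction (fun hwc => sel_induction
        (fun hbc => ?_) fun hbc => hr) fun hwc => hr) fun hac => hr
      simp only [nbrs, disj_pow_mask, disj_pow_mask_false, hi, hj, hk] at hwa hwb hab hwc hbc hac
      refine avoids_addPattern_of_path (i := i) (j := j) (k := k) hG hr fun x h => ?_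
      simp only [List.forall_mem_cons, testBit_lor, testBit_pow, Bool.or_eq_true,
        decide_eq_true_iff, Nat.add_sub_cancel] at h
      exact ⟨f k, x, f i, f n, f j, by grind⟩
    · refine foldList_induction hr fun c hc r hr => ?_
      obtain ⟨k, hk, rfl⟩ := mem_verts hc
      refine sel_induction (fun hac => sel_induction (fun hbc => sel_induction (fun hwc => ?_)
        fun hwc => ?_) fun hbc => sel_induction (fun hwc => ?_) fun hwc => hr) fun hac => hr <;>
      simp only [nbrs, disj_pow_mask, disj_pow_mask_false, hi, hj, hk] at hwa hwb hab hwc hbc hac <;>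
      refine avoids_addPattern_of_path (i := i) (j := j) (k := k) hG
        (avoids_addPattern_of_path (i := i) (j := j) (k := k) hG hr fun x h => ?_) fun x h => ?_ <;>
      simp only [List.forall_mem_cons, testBit_lor, testBit_pow, Bool.or_eq_true,
        decide_eq_true_iff, Nat.add_sub_cancel] at h
      · exact ⟨f k, x, f j, f i, f n, by grind⟩
      · exact ⟨f k, x, f n, f i, f j, by grind⟩
      · exact ⟨f k, f n, f i, f j, x, by grind⟩
      · exact ⟨x, f k, f n, f i, f j, by grind⟩
      · exact ⟨f n, f i, f j, f k, x, by grind⟩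
      · exact ⟨x, f n, f i, f j, f k, by grind⟩

section Update

variable {f : ℕ → V} {n : ℕ} {w : V}

lemma update_of_lt {i : ℕ} (hi : i < n) : Function.update f n w i = f i :=
  Function.update_of_ne hi.ne _ _

lemma nbrs_update (x : V) : nbrs G (Function.update f n w) n x = nbrs G f n x :=
  mask_congr fun i hi => by rw [update_of_lt hi]

lemma nbrs_update_of_adj {x : V} (h : G.Adj w x) :
    nbrs G (Function.update f n w) (n + 1) x = Nat.lor (nbrs G f n x) (Nat.pow 2 n) :=
  (mask_succ_of_pos (by simpa using h)).trans (by rw [← nbrs_update x]; rfl)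

lemma nbrs_update_of_not_adj {x : V} (h : ¬ G.Adj w x) :
    nbrs G (Function.update f n w) (n + 1) x = nbrs G f n x :=
  (mask_succ_of_neg (by simpa using h)).trans (nbrs_update x)

lemma nbrs_update_succ (x : V) : nbrs G (Function.update f n w) (n + 1) x = nbrs G f n x ∨
    nbrs G (Function.update f n w) (n + 1) x = Nat.lor (nbrs G f n x) (Nat.pow 2 n) := by
  by_cases h : G.Adj w x
  · exact .inr (nbrs_update_of_adj h)
  · exact .inl (nbrs_update_of_not_adj h)

lemma verts_update : verts G (Function.update f n w) (n + 1) =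
    addVertex (Nat.pow 2 n) (nbrs G f n w) (verts G f n) := by
  rw [addVertex, foldList_cons, verts, verts, List.range_succ, List.map_append, List.map_map]
  congr 1
  · refine List.map_congr_left fun i hi => ?_
    have hi := List.mem_range.1 hi
    rw [update_of_lt hi, Function.comp_apply, Prod.mk.injEq]
    refine ⟨rfl, ?_⟩
    change _ = sel (disj (Nat.pow 2 i) (nbrs G f n w)) (nbrs G f n (f i))
      (Nat.lor (nbrs G f n (f i)) (Nat.pow 2 n))
    by_cases h : G.Adj w (f i)
    · have hd : disj (Nat.pow 2 i) (nbrs G f n w) = false := (disj_pow_mask_false hi).2 h.symm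
      rw [hd]
      exact nbrs_update_of_adj h
    · have hd : disj (Nat.pow 2 i) (nbrs G f n w) = true := (disj_pow_mask hi).2 (h ·.symm)
      rw [hd]
      exact nbrs_update_of_not_adj h
  · rw [List.map_singleton, Function.update_self, nbrs_update_of_not_adj (G.irrefl (v := w))]

lemma disj_mask_nbrs {c : V → Fin 3} {s : Set V} {x : V} {k : Fin 3} (hc : ProperOn G s c)
    (hf : ∀ i < n, f i ∈ s) (hx : x ∈ s) (hk : c x = k) :
    disj (mask (fun i => c (f i) = k) n) (nbrs G f n x) = true := by
  refine disj_iff.2 fun i ⟨h₁, h₂⟩ => ?_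
  obtain ⟨hi, h₁⟩ := testBit_mask.1 h₁
  exact hc _ (hf i hi) _ hx (testBit_mask.1 h₂).2 (h₁.trans hk.symm)

lemma colorExtends_of_mem {C : List (ℕ × ℕ × ℕ)} {c : V → Fin 3} {s : Set V} {x : V}
    (hC : classes f n c ∈ C) (hc : ProperOn G s c) (hf : ∀ i < n, f i ∈ s) (hx : x ∈ s) :
    colorExtends C (nbrs G f n x) = true := by
  refine foldList_of_mem (P := (· = true)) hC (fun r => ?_) fun b r hr => ?_
  · have h := disj_mask_nbrs hc hf hx rfl
    rcases (by omega : c x = 0 ∨ c x = 1 ∨ c x = 2) with hk | hk | hk <;> rw [hk] at h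
    · exact sel_induction (P := (· = true)) (fun _ => rfl) fun h' => absurd h (by simpa [classes] using h')
    · exact sel_induction (P := (· = true)) (fun _ => rfl) fun _ => sel_induction (P := (· = true)) (fun _ => rfl)
        fun h' => absurd h (by simpa [classes] using h')
    · exact sel_induction (P := (· = true)) (fun _ => rfl) fun _ => sel_induction (P := (· = true)) (fun _ => rfl)
        fun _ => sel_induction (P := (· = true)) (fun _ => rfl) fun h' => absurd h (by simpa [classes] using h')
  · exact sel_induction (P := (· = true)) (fun _ => rfl) fun _ => sel_induction (P := (· = true)) (fun _ => rfl)
      fun _ => sel_induction (P := (· = true)) (fun _ => rfl) fun _ => hr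

lemma mask_update_pos {c : V → Fin 3} {k : Fin 3} (h : c w = k) :
    mask (fun i => c (Function.update f n w i) = k) (n + 1) =
      Nat.lor (mask (fun i => c (f i) = k) n) (Nat.pow 2 n) := by
  rw [mask_succ_of_pos (by simpa using h)]
  exact congrArg (Nat.lor · _) (mask_congr fun i hi => by rw [update_of_lt hi])

lemma mask_update_neg {c : V → Fin 3} {k : Fin 3} (h : c w ≠ k) :
    mask (fun i => c (Function.update f n w i) = k) (n + 1) = mask (fun i => c (f i) = k) n := by
  rw [mask_succ_of_neg (by simpa using h)]
  exact mask_congr fun i hi => by rw [update_of_lt hi]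

lemma classes_update_mem {C : List (ℕ × ℕ × ℕ)} {c : V → Fin 3} {s : Set V}
    (hC : classes f n c ∈ C) (hc : ProperOn G s c) (hf : ∀ i < n, f i ∈ s) (hw : w ∈ s) :
    classes (Function.update f n w) (n + 1) c ∈
      addColor (Nat.pow 2 n) (nbrs G f n w) C := by
  refine foldList_of_mem hC (fun r => ?_) fun b r hr =>
    mem_sel_cons (mem_sel_cons (mem_sel_cons hr))
  have h := disj_mask_nbrs hc hf hw rfl
  rcases (by omega : c w = 0 ∨ c w = 1 ∨ c w = 2) with hk | hk | hk <;> rw [hk] at h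
  · simp only [classes, h, sel_true, mask_update_pos hk,
      mask_update_neg (show c w ≠ 1 by simp [hk]), mask_update_neg (show c w ≠ 2 by simp [hk])]
    exact List.mem_cons_self
  · refine mem_sel_cons ?_
    simp only [classes, h, sel_true, mask_update_pos hk,
      mask_update_neg (show c w ≠ 0 by simp [hk]), mask_update_neg (show c w ≠ 2 by simp [hk])]
    exact List.mem_cons_self
  · refine mem_sel_cons (mem_sel_cons ?_)
    simp only [classes, h, sel_true, mask_update_pos hk,
      mask_update_neg (show c w ≠ 0 by simp [hk]), mask_update_neg (show c w ≠ 1 by simp [hk])]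
    exact List.mem_cons_self

end Update

lemma mem_addTypes {w y y' : ℕ} {T : List ℕ} {P : List (ℕ × ℕ)} {C : List (ℕ × ℕ × ℕ)}
    (hy : y ∈ T) (h : y' = y ∨ y' = Nat.lor y w) (hP : ∀ q ∈ P, misses y' q = true)
    (hC : colorExtends C y' = true) : y' ∈ addTypes w T P C := by
  have hy' : admissible P C y' = true := by rw [admissible, allList_of_forall hP, sel_true, hC]
  refine foldList_of_mem hy (fun r => ?_) fun b r hr => mem_sel_cons (mem_sel_cons hr)
  rcases h with rfl | rfl
  · dsimp only
    rw [hy', sel_true]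
    exact List.mem_cons_self
  · refine mem_sel_cons ?_
    rw [hy', sel_true]
    exact List.mem_cons_self

/-- Non-3-colourable graphs all of whose proper induced subgraphs are 3-colourable. -/
structure Critical (G : SimpleGraph V) : Prop where
  not_proper : ∀ c, ¬ ProperOn G Set.univ c
  exists_proper : ∀ v, ∃ c, ProperOn G {v}ᶜ c

/-- The vertices `f 0, …, f (n - 1)` are distinct, every other vertex has a neighbourhood mask in
`T`, and every 3-colouring of them with `f 0` of colour `0` is in `C`. -/
structure State (G : SimpleGraph V) (f : ℕ → V) (n : ℕ) (T : List ℕ)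
    (C : List (ℕ × ℕ × ℕ)) : Prop where
  pos : 0 < n
  inj : Set.InjOn f (Set.Iio n)
  types : ∀ x ∉ f '' Set.Iio n, nbrs G f n x ∈ T
  colors : ∀ c, c (f 0) = 0 → ProperOn G (f '' Set.Iio n) c → classes f n c ∈ C

lemma ProperOn.mono {s t : Set V} {c : V → Fin 3} (h : ProperOn G t c) (hst : s ⊆ t) :
    ProperOn G s c := fun a ha b hb => h a (hst ha) b (hst hb)

lemma Critical.exists_proper_of_ncard [Fintype V] (hG : Critical G) {s : Set V}
    (hs : s.ncard < Fintype.card V) (u : V) : ∃ c, c u = 0 ∧ ProperOn G s c := by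
  obtain ⟨v, hv⟩ : ∃ v, v ∉ s := by
    by_contra! h
    rw [Set.eq_univ_of_forall h, Set.ncard_univ, Nat.card_eq_fintype_card] at hs
    exact hs.false
  obtain ⟨c, hc⟩ := hG.exists_proper v
  refine ⟨fun x => Equiv.swap (c u) 0 (c x), Equiv.swap_apply_left _ _, fun a ha b hb h => ?_⟩
  exact (Equiv.swap (c u) 0).injective.ne
    (hc a (by rintro rfl; exact hv ha) b (by rintro rfl; exact hv hb) h)

lemma State.add [Fintype V] (hP : NoInducedP5 G) (hG : Critical G) {f : ℕ → V} {n : ℕ} {T : List ℕ}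
    {C : List (ℕ × ℕ × ℕ)} (h : State G f n T C) (hn : n + 2 < Fintype.card V) {w : V}
    (hw : w ∉ f '' Set.Iio n) :
    State G (Function.update f n w) (n + 1)
      (addTypes (Nat.pow 2 n) T (patterns (Nat.pow 2 n) (nbrs G f n w) (verts G f n))
        (addColor (Nat.pow 2 n) (nbrs G f n w) C))
      (addColor (Nat.pow 2 n) (nbrs G f n w) C) := by
  have himage : Function.update f n w '' Set.Iio (n + 1) = insert w (f '' Set.Iio n) := by
    rw [show Set.Iio (n + 1) = insert n (Set.Iio n) by ext; simp, Set.image_insert_eq,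
      Function.update_self]
    congr 1
    exact Set.image_congr fun i hi => update_of_lt hi
  have hzero : Function.update f n w 0 = f 0 := update_of_lt h.pos
  have hcolors : ∀ c, c (Function.update f n w 0) = 0 →
      ProperOn G (Function.update f n w '' Set.Iio (n + 1)) c →
      classes (Function.update f n w) (n + 1) c ∈ addColor (Nat.pow 2 n) (nbrs G f n w) C := by
    intro c hc₀ hc
    rw [himage] at hc
    refine classes_update_mem (h.colors c (hzero ▸ hc₀) (hc.mono (Set.subset_insert _ _))) hc
      (fun i hi => .inr ⟨i, hi, rfl⟩) (.inl rfl)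
  refine ⟨n.succ_pos, ?_, fun x hx => ?_, hcolors⟩
  · intro i hi j hj hij
    simp only [Set.mem_Iio] at hi hj
    rcases Nat.lt_succ_iff_lt_or_eq.1 hi with hi | rfl <;>
    rcases Nat.lt_succ_iff_lt_or_eq.1 hj with hj | rfl
    · rw [update_of_lt hi, update_of_lt hj] at hij
      exact h.inj hi hj hij
    · rw [update_of_lt hi, Function.update_self] at hij
      exact (hw ⟨i, hi, hij⟩).elim
    · rw [update_of_lt hj, Function.update_self] at hij
      exact (hw ⟨j, hj, hij.symm⟩).elim
    · rfl
  · have hx' : x ∉ f '' Set.Iio n := fun h' => hx (himage ▸ .inr h')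
    refine mem_addTypes (h.types x hx') (nbrs_update_succ x) (fun q hq => ?_) ?_
    · refine avoids_patterns hP q ?_ x
      convert hq using 2
      · rw [nbrs_update, Function.update_self]
      · refine List.map_congr_left fun i hi => ?_
        rw [nbrs_update, update_of_lt (List.mem_range.1 hi)]
    · have hcard : (insert x (Function.update f n w '' Set.Iio (n + 1))).ncard <
          Fintype.card V := by
        refine (Set.ncard_insert_le _ _).trans_lt ?_
        have := Set.ncard_image_le (f := Function.update f n w) (Set.finite_Iio (n + 1))
        rw [← Finset.coe_Iio, Set.ncard_coe_finset, Nat.card_Iio] at this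
        rw [← Finset.coe_Iio]
        omega
      obtain ⟨c, hc₀, hc⟩ := hG.exists_proper_of_ncard hcard (Function.update f n w 0)
      exact colorExtends_of_mem (hcolors c hc₀ (hc.mono (Set.subset_insert _ _))) hc
        (fun i hi => .inr ⟨i, hi, rfl⟩) (.inl rfl)

section Sound

variable {f : ℕ → V} {n : ℕ} {T : List ℕ} {C : List (ℕ × ℕ × ℕ)}

lemma testBit_nbrs {i : ℕ} (hi : i < n) {x : V} :
    (nbrs G f n x).testBit i = true ↔ G.Adj (f i) x :=
  testBit_mask.trans (and_iff_right hi)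

lemma Critical.exists_eq_of_hom (hG : Critical G) (g : G →g G) (v : V) : ∃ x, g x = v := by
  by_contra! h
  obtain ⟨c, hc⟩ := hG.exists_proper v
  exact hG.not_proper (c ∘ g) fun a _ b _ hab => hc _ (h a) _ (h b) (g.map_adj hab)

open Classical in
lemma State.foldable_eq_false (hG : Critical G) (h : State G f n T C) {φ : ℕ → ℕ} :
    foldable n (verts G f n) T φ ≠ true := by
  intro hφ
  simp only [foldable, Bool.and_eq_true, List.any_eq_true, List.all_eq_true, List.mem_range,
    Bool.or_eq_true, Bool.not_eq_true', Nat.beq_eq, Nat.blt_eq, disj_pow] at hφ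
  obtain ⟨⟨k, hk, hφk⟩, hφ⟩ := hφ
  have hlt : ∀ i < n, φ i < n := fun i hi => by
    rcases hφ i hi with h' | h'
    · exact h'.symm ▸ hi
    · exact h'.1.1
  have hin : ∀ i < n, ∀ j < n, φ i ≠ i → G.Adj (f j) (f i) → G.Adj (f (φ j)) (f (φ i)) := by
    intro i hi j hj hne hadj
    have := ((hφ i hi).resolve_left hne).1.2 j hj
    rw [row_verts hi, row_verts (hlt i hi)] at this
    rw [← testBit_nbrs hj] at hadj
    rw [← testBit_nbrs (hlt j hj)]
    grind [disj_pow]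
  have hout : ∀ i < n, ∀ x ∉ f '' Set.Iio n, G.Adj (f i) x → G.Adj (f (φ i)) x := by
    intro i hi x hx hadj
    rcases hφ i hi with h' | h'
    · rwa [h']
    · have := h'.2 _ (h.types x hx)
      rw [← testBit_nbrs hi] at hadj
      rw [← testBit_nbrs (hlt i hi)]
      grind [disj_pow]
  let g : V → V := fun x => if hx : ∃ i, i < n ∧ f i = x then f (φ hx.choose) else x
  have hgf : ∀ i < n, g (f i) = f (φ i) := by
    intro i hi
    have hx : ∃ j, j < n ∧ f j = f i := ⟨i, hi, rfl⟩
    have := h.inj hx.choose_spec.1 hi hx.choose_spec.2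
    simp only [g, dif_pos hx, this]
  have hgo : ∀ x ∉ f '' Set.Iio n, g x = x := fun x hx => dif_neg hx
  have hadj : ∀ a b, G.Adj a b → G.Adj (g a) (g b) := by
    intro a b hab
    by_cases ha : a ∈ f '' Set.Iio n <;> by_cases hb : b ∈ f '' Set.Iio n
    · obtain ⟨i, hi, rfl⟩ := ha
      obtain ⟨j, hj, rfl⟩ := hb
      rw [hgf i hi, hgf j hj]
      by_cases hij : φ j = j
      · by_cases hji : φ i = i
        · rwa [hij, hji]
        · exact (hin i hi j hj hji hab.symm).symm
      · exact hin j hj i hi hij hab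
    · obtain ⟨i, hi, rfl⟩ := ha
      rw [hgf i hi, hgo b hb]
      exact hout i hi b hb hab
    · obtain ⟨j, hj, rfl⟩ := hb
      rw [hgf j hj, hgo a ha]
      exact (hout j hj a ha hab.symm).symm
    · rwa [hgo a ha, hgo b hb]
  obtain ⟨x, hx⟩ := hG.exists_eq_of_hom ⟨g, hadj _ _⟩ (f k)
  change g x = f k at hx
  by_cases hxf : x ∈ f '' Set.Iio n
  · obtain ⟨i, hi, rfl⟩ := hxf
    rw [hgf i hi] at hx
    exact Bool.noConfusion ((Nat.beq_eq.mpr (h.inj (hlt i hi) hk hx)).symm.trans (hφk i hi))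
  · rw [hgo x hxf] at hx
    exact hxf ⟨k, hk, hx.symm⟩

open Classical in
lemma State.lowDegree_eq_false (hG : Critical G) (h : State G f n T C) {p a b : ℕ} :
    lowDegree n (verts G f n) T p a b ≠ true := by
  intro hp
  simp only [lowDegree, Bool.and_eq_true, List.all_eq_true, List.mem_range,
    Bool.or_eq_true, Nat.beq_eq, Nat.blt_eq, disj_pow] at hp
  obtain ⟨⟨hp, hin⟩, hout⟩ := hp
  have hadj : ∀ x, G.Adj (f p) x → x = f a ∨ x = f b := by
    intro x hx
    by_cases hxf : x ∈ f '' Set.Iio n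
    · obtain ⟨i, hi, rfl⟩ := hxf
      have := hin i hi
      rw [row_verts hp] at this
      have := (testBit_nbrs hi).2 hx.symm
      grind
    · have := hout _ (h.types x hxf)
      have := (testBit_nbrs hp).2 hx
      grind
  obtain ⟨c, hc⟩ := hG.exists_proper (f p)
  obtain ⟨k, hka, hkb⟩ : ∃ k, k ≠ c (f a) ∧ k ≠ c (f b) := by
    generalize c (f a) = x
    generalize c (f b) = y
    revert x y
    decide
  have hk : ∀ x, G.Adj (f p) x → k ≠ c x := by
    intro x hx
    rcases hadj x hx with rfl | rfl
    exacts [hka, hkb]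
  refine hG.not_proper (Function.update c (f p) k) fun x _ y _ hxy => ?_
  by_cases hx : x = f p
  · subst hx
    rw [Function.update_self, Function.update_of_ne hxy.ne']
    exact hk y hxy
  · by_cases hy : y = f p
    · subst hy
      rw [Function.update_self, Function.update_of_ne hx]
      exact (hk x hxy.symm).symm
    · rw [Function.update_of_ne hx, Function.update_of_ne hy]
      exact hc x hx y hy hxy

lemma State.remove {t : ℕ} (h : State G f n T C) (ht : ∀ x ∉ f '' Set.Iio n, nbrs G f n x ≠ t) :
    State G f n (foldList T (fun y z => sel (Nat.beq y t) z (y :: z)) []) C := by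
  refine ⟨h.pos, h.inj, fun x hx => ?_, h.colors⟩
  refine foldList_of_mem (h.types x hx) (fun r => ?_) fun y r hr => ?_
  · rw [Bool.eq_false_iff.2 fun h' => ht x hx (Nat.beq_eq.mp h'), sel_false]
    exact List.mem_cons_self
  · exact sel_induction (P := (nbrs G f n x ∈ ·)) (fun _ => hr) fun _ => List.mem_cons_of_mem _ hr

lemma State.check_eq_false [Fintype V] (hP : NoInducedP5 G) (hG : Critical G)
    (hcard : 13 < Fintype.card V) (cert : Certificate) (h : State G f n T C) :
    check cert n (verts G f n) T C ≠ true := by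
  induction cert generalizing f n T C with
  | branch t present absent ihp iha =>
    intro hc
    simp only [check, Bool.and_eq_true, Nat.blt_eq] at hc
    obtain ⟨hn, hc₁, hc₂⟩ := hc
    by_cases ht : ∃ w ∉ f '' Set.Iio n, nbrs G f n w = t
    · obtain ⟨w, hw, rfl⟩ := ht
      rw [← verts_update] at hc₁
      exact ihp (h.add hP hG (by omega) hw) hc₁
    · exact iha (h.remove fun x hx hxt => ht ⟨x, hx, hxt⟩) hc₂
  | fold l => exact h.foldable_eq_false hG
  | low p a b => exact h.lowDegree_eq_false hG

lemma mask_one_of_pos {p : ℕ → Prop} (h : p 0) : mask p 1 = 1 :=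
  (mask_succ_of_pos h).trans (by rw [mask]; rfl)

lemma mask_one_of_neg {p : ℕ → Prop} (h : ¬ p 0) : mask p 1 = 0 := (mask_succ_of_neg h).trans rfl

lemma state_one (v : V) : State G (fun _ => v) 1 [0, 1] [(1, 0, 0)] := by
  refine ⟨one_pos, fun i hi j hj _ => ?_, fun x _ => ?_, fun c hc _ => ?_⟩
  · simp only [Set.mem_Iio] at hi hj
    omega
  · by_cases h : G.Adj v x
    · simp [nbrs, mask_one_of_pos (p := fun _ => G.Adj v x) h]
    · simp [nbrs, mask_one_of_neg (p := fun _ => G.Adj v x) h]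
  · rw [classes, mask_one_of_pos hc, mask_one_of_neg (by simp [hc]),
      mask_one_of_neg (by simp [hc])]
    exact List.mem_cons_self

lemma verts_one (v : V) : verts G (fun _ => v) 1 = [(1, 0)] :=
  congrArg (fun m => [(1, m)]) (mask_one_of_neg (G.irrefl (v := v)))

end Sound

end Soundness

lemma critical {V : Type} {G : SimpleGraph V} (h : IsVertexCritical G 4) : Critical G := by
  refine ⟨fun c hc => ?_, fun v => ?_⟩
  · have h₃ : G.Colorable 3 := ⟨Coloring.mk c fun {a b} hab => hc a trivial b trivial hab⟩
    have := chromaticNumber_le_iff_colorable.2 h₃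
    rw [h.1] at this
    exact absurd this (by decide)
  · have h₃ : (G.induce {u | u ≠ v}).Colorable 3 := by
      refine chromaticNumber_le_iff_colorable.1 (Order.le_of_lt_add_one ?_)
      exact (h.2 v).trans_eq (by norm_num)
    obtain ⟨c⟩ := h₃
    classical
    refine ⟨fun x => if hx : x ≠ v then c ⟨x, hx⟩ else 0, fun a ha b hb hab => ?_⟩
    simp only [dif_pos (show a ≠ v from ha), dif_pos (show b ≠ v from hb)]
    exact c.valid (v := ⟨a, ha⟩) (w := ⟨b, hb⟩) hab

lemma noInducedP5 {V : Type} {G : SimpleGraph V} (h : ¬ ContainsInduced G P5) : NoInducedP5 G := by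
  intro a b c d e hab hbc hcd hde hac had hae hbd hbe hce
  have hadj : ∀ i j, P5.Adj i j ↔ G.Adj (![a, b, c, d, e] i) (![a, b, c, d, e] j) := by
    intro i j
    fin_cases i <;> fin_cases j <;>
      simp [P5, pathGraph_adj, hab, hbc, hcd, hde, hac, had, hae, hbd, hbe, hce, hab.symm,
        hbc.symm, hcd.symm, hde.symm, G.adj_comm c a, G.adj_comm d a, G.adj_comm e a,
        G.adj_comm d b, G.adj_comm e b, G.adj_comm e c]
  have hsep : ∀ i j, (∀ k, P5.Adj i k ↔ P5.Adj j k) → i = j := by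
    simp only [P5, pathGraph_adj]
    decide
  refine h ⟨⟨![a, b, c, d, e], fun i j hij => hsep i j fun k => ?_⟩, hadj⟩
  rw [hadj, hadj, hij]

/-- The case distinction covering all critical graphs on more than 13 vertices. -/
def cert : Certificate :=
  (.branch 1 (.branch 3 (.branch 3 (.branch 5 (.branch 10 (.fold [(4, 1)]) (.branch 24 (.fold [(5,
  0)]) (.branch 26 (.branch 28 (.branch 36 (.fold [(6, 0)]) (.branch 44 (.branch 210 (.branch 225
  (.branch 353 (.branch 1682 (.fold [(10, 4)]) (.fold [(9, 3)])) (.fold [(8, 2)])) (.fold [(7,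
  1)])) (.fold [(6, 0)])) (.fold [(5, 0)]))) (.fold [(4, 1)])) (.fold [(3, 2)])))) (.branch 6
  (.branch 9 (.fold [(4, 0)]) (.branch 24 (.fold [(5, 1)]) (.branch 25 (.branch 28 (.branch 36
  (.fold [(6, 1)]) (.branch 44 (.branch 209 (.branch 226 (.branch 354 (.branch 1681 (.fold [(10,
  4)]) (.fold [(9, 3)])) (.fold [(8, 2)])) (.fold [(7, 0)])) (.fold [(6, 1)])) (.fold [(5, 1)])))
  (.fold [(4, 0)])) (.fold [(3, 2)])))) (.branch 4 (.branch 24 (.branch 19 (.branch 28 (.fold [(6,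
  2)]) (.fold [(2, 6)])) (.branch 51 (.branch 36 (.fold [(3, 6)]) (.fold [(2, 6)])) (.branch 24
  (.branch 44 (.fold [(6, 5)]) (.fold [(5, 6)])) (.branch 28 (.branch 36 (.branch 227 (.fold [(3,
  8)]) (.fold [(7, 4)])) (.branch 44 (.branch 192 (.fold [(8, 2)]) (.branch 28 (.branch 300 (.fold
  [(6, 8)]) (.fold [(8, 6)])) (.branch 100 (.fold [(4, 8)]) (.fold [(2, 3), (4, 7), (6, 5)]))))
  (.fold [(5, 6)]))) (.low 4 2 5))))) (.branch 25 (.fold [(4, 0)]) (.branch 26 (.fold [(4, 1)])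
  (.fold [(3, 2)])))) (.fold [(2, 3)])))) (.branch 5 (.branch 12 (.branch 18 (.fold [(5, 2)])
  (.fold [(1, 3)])) (.branch 8 (.branch 18 (.branch 21 (.branch 26 (.fold [(6, 3)]) (.fold [(3,
  6)])) (.branch 53 (.branch 18 (.fold [(3, 6)]) (.fold [(1, 6)])) (.branch 18 (.branch 42 (.fold
  [(6, 5)]) (.fold [(5, 6)])) (.branch 26 (.branch 40 (.branch 229 (.fold [(1, 8)]) (.fold [(7,
  4)])) (.branch 42 (.branch 192 (.fold [(8, 1)]) (.branch 26 (.branch 298 (.fold [(6, 8)]) (.fold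
  [(8, 6)])) (.branch 104 (.fold [(4, 8)]) (.fold [(3, 1), (4, 7), (6, 5)])))) (.fold [(5, 6)])))
  (.low 4 3 5))))) (.branch 22 (.fold [(4, 2)]) (.fold [(1, 3)]))) (.branch 9 (.branch 18 (.fold
  [(5, 0)]) (.branch 26 (.branch 22 (.branch 74 (.branch 180 (.branch 225 (.branch 353 (.branch
  1684 (.fold [(10, 4)]) (.fold [(9, 1)])) (.fold [(8, 3)])) (.fold [(7, 2)])) (.fold [(5, 0)]))
  (.fold [(6, 0)])) (.fold [(1, 3)])) (.fold [(4, 2)]))) (.fold [(3, 1)])))) (.branch 1 (.branch 2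
  (.branch 18 (.branch 9 (.branch 49 (.branch 132 (.fold [(8, 0)]) (.fold [(7, 1)])) (.branch 18
  (.branch 34 (.fold [(7, 5)]) (.fold [(5, 7)])) (.low 4 1 5))) (.branch 60 (.branch 10 (.branch
  188 (.fold [(6, 8)]) (.fold [(7, 0)])) (.branch 74 (.branch 132 (.fold [(8, 1)]) (.branch 65
  (.fold [(8, 3)]) (.branch 14 (.fold [(0, 8)]) (.fold [(0, 7), (1, 6), (2, 3)])))) (.fold [(3,
  2)]))) (.fold [(3, 1)]))) (.branch 17 (.branch 9 (.branch 49 (.fold [(4, 0)]) (.branch 124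
  (.branch 36 (.fold [(8, 0)]) (.branch 17 (.branch 380 (.fold [(7, 9)]) (.fold [(8, 1)])) (.branch
  130 (.branch 401 (.branch 380 (.fold [(10, 7)]) (.fold [(5, 9)])) (.fold [(8, 2)])) (.branch 110
  (.fold [(0, 8)]) (.fold [(0, 7), (1, 5), (2, 4)]))))) (.branch 36 (.branch 126 (.fold [(0, 8)])
  (.fold [(4, 0)])) (.fold [(5, 1)])))) (.branch 42 (.branch 60 (.branch 92 (.branch 126 (.fold
  [(0, 9)]) (.branch 62 (.fold [(0, 9)]) (.branch 46 (.fold [(0, 9)]) (.fold [(0, 6), (1, 8), (2,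
  3)])))) (.fold [(3, 5)])) (.branch 62 (.fold [(0, 7)]) (.fold [(4, 6)]))) (.fold [(3, 2)])))
  (.fold [(4, 2)]))) (.branch 6 (.branch 24 (.branch 14 (.branch 25 (.fold [(6, 0)]) (.fold [(0,
  6)])) (.branch 46 (.branch 33 (.fold [(4, 6)]) (.fold [(0, 6)])) (.branch 24 (.branch 49 (.fold
  [(6, 5)]) (.fold [(5, 6)])) (.branch 25 (.branch 33 (.branch 230 (.fold [(4, 8)]) (.fold [(7,
  3)])) (.branch 49 (.branch 192 (.fold [(8, 0)]) (.branch 25 (.branch 305 (.fold [(6, 8)]) (.fold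
  [(8, 6)])) (.branch 97 (.fold [(3, 8)]) (.fold [(0, 4), (3, 7), (6, 5)])))) (.fold [(5, 6)])))
  (.low 3 0 5))))) (.branch 26 (.fold [(3, 1)]) (.branch 28 (.fold [(3, 2)]) (.fold [(4, 0)]))))
  (.branch 10 (.branch 24 (.branch 14 (.fold [(0, 6)]) (.fold [(0, 4), (1, 3), (2, 5)])) (.branch
  25 (.branch 20 (.branch 65 (.branch 234 (.fold [(4, 8)]) (.fold [(7, 2)])) (.branch 81 (.branch
  20 (.branch 337 (.branch 490 (.fold [(10, 4)]) (.fold [(7, 9)])) (.fold [(8, 1)])) (.branch 174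
  (.fold [(0, 8)]) (.fold [(0, 4), (1, 6), (2, 7)]))) (.fold [(6, 1)]))) (.fold [(4, 0)])) (.branch
  28 (.branch 12 (.branch 76 (.branch 33 (.fold [(8, 2)]) (.branch 10 (.fold [(8, 4)]) (.branch 14
  (.fold [(0, 8)]) (.branch 20 (.fold [(8, 5)]) (.fold [(0, 4), (1, 5), (2, 3)]))))) (.branch 81
  (.branch 209 (.fold [(6, 0)]) (.fold [(7, 3)])) (.fold [(6, 5)]))) (.branch 14 (.fold [(0, 6)])
  (.branch 17 (.branch 81 (.branch 10 (.fold [(8, 0)]) (.branch 20 (.fold [(8, 5)]) (.branch 33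
  (.fold [(8, 3)]) (.fold [(0, 4), (1, 5), (2, 3)])))) (.fold [(6, 3)])) (.branch 46 (.branch 33
  (.fold [(4, 6)]) (.fold [(0, 6)])) (.fold [(0, 5), (1, 3), (2, 4)]))))) (.branch 12 (.branch 44
  (.branch 20 (.branch 241 (.fold [(3, 8)]) (.fold [(7, 1)])) (.fold [(4, 0)])) (.branch 46 (.fold
  [(0, 6)]) (.branch 42 (.branch 65 (.branch 26 (.fold [(7, 1)]) (.fold [(4, 6)])) (.branch 12
  (.branch 26 (.fold [(7, 5)]) (.fold [(4, 6)])) (.branch 14 (.fold [(0, 7)]) (.fold [(0, 5), (1,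
  3), (2, 6)])))) (.fold [(5, 0)])))) (.fold [(3, 1)]))))) (.branch 14 (.branch 9 (.branch 48
  (.branch 65 (.branch 206 (.fold [(4, 8)]) (.fold [(7, 5)])) (.branch 81 (.branch 136 (.fold [(8,
  0)]) (.branch 48 (.branch 337 (.branch 462 (.fold [(10, 4)]) (.fold [(7, 9)])) (.fold [(8, 3)]))
  (.branch 49 (.branch 337 (.branch 686 (.fold [(10, 0)]) (.fold [(3, 8)])) (.fold [(8, 3)]))
  (.branch 73 (.branch 238 (.fold [(4, 9)]) (.fold [(5, 8)])) (.branch 174 (.branch 177 (.fold [(8,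
  0)]) (.fold [(0, 8)])) (.fold [(0, 4), (3, 6), (5, 7)])))))) (.fold [(6, 3)]))) (.fold [(4, 0)]))
  (.branch 1 (.branch 52 (.fold [(5, 2)]) (.branch 60 (.fold [(3, 2)]) (.branch 48 (.branch 25
  (.fold [(1, 3), (2, 7)]) (.branch 89 (.fold [(5, 7)]) (.branch 56 (.branch 110 (.fold [(0, 8)])
  (.fold [(6, 7)])) (.branch 57 (.fold [(6, 7)]) (.fold [(3, 1)]))))) (.branch 56 (.branch 49
  (.branch 136 (.fold [(8, 0)]) (.branch 65 (.branch 305 (.branch 430 (.fold [(10, 0)]) (.fold [(7,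
  9)])) (.fold [(8, 3)])) (.branch 56 (.branch 238 (.fold [(0, 9)]) (.branch 81 (.fold [(9, 3)])
  (.fold [(6, 8)]))) (.branch 81 (.branch 305 (.branch 718 (.fold [(10, 4)]) (.fold [(3, 8)]))
  (.fold [(8, 3)])) (.branch 206 (.branch 209 (.fold [(8, 4)]) (.fold [(4, 8)])) (.fold [(3, 5),
  (4, 0), (6, 7)])))))) (.fold [(5, 3)])) (.fold [(4, 0)]))))) (.fold [(0, 4)]))) (.low 1 0 2)))))
  (.low 0 1 2)))) (.branch 1 (.branch 2 (.branch 10 (.branch 13 (.branch 13 (.fold [(5, 6)])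
  (.branch 38 (.fold [(0, 6)]) (.low 2 0 5))) (.branch 28 (.branch 25 (.fold [(1, 6)]) (.branch 29
  (.branch 6 (.fold [(5, 6)]) (.fold [(1, 6)])) (.branch 33 (.branch 38 (.fold [(6, 2)]) (.fold
  [(2, 6)])) (.low 0 1 2)))) (.branch 29 (.branch 6 (.branch 96 (.branch 217 (.fold [(1, 8)])
  (.fold [(7, 2)])) (.branch 98 (.branch 129 (.fold [(8, 1)]) (.branch 6 (.branch 354 (.branch 473
  (.fold [(10, 1)]) (.fold [(7, 9)])) (.fold [(8, 0)])) (.branch 38 (.branch 354 (.branch 669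
  (.fold [(10, 5)]) (.fold [(0, 8)])) (.fold [(8, 0)])) (.branch 97 (.branch 221 (.fold [(1, 9)])
  (.fold [(2, 8)])) (.branch 157 (.branch 166 (.fold [(8, 5)]) (.fold [(5, 8)])) (.fold [(0, 6),
  (2, 7), (5, 1)])))))) (.fold [(6, 0)]))) (.fold [(1, 5)])) (.branch 10 (.branch 18 (.fold [(5,
  4)]) (.fold [(4, 5)])) (.branch 25 (.branch 2 (.branch 5 (.branch 97 (.fold [(6, 0)]) (.fold [(5,
  1)])) (.fold [(2, 1)])) (.fold [(1, 5)])) (.low 3 1 4)))))) (.branch 12 (.branch 30 (.fold [(0,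
  5)]) (.branch 22 (.branch 17 (.branch 78 (.branch 105 (.branch 237 (.fold [(8, 9)]) (.branch 233
  (.branch 110 (.branch 790 (.fold [(8, 9)]) (.fold [(4, 10)])) (.branch 78 (.branch 1457 (.fold
  [(2, 11)]) (.fold [(8, 9)])) (.fold [(1, 9)]))) (.branch 334 (.branch 109 (.branch 689 (.fold
  [(7, 9)]) (.fold [(4, 10)])) (.branch 105 (.branch 1430 (.fold [(5, 11)]) (.fold [(7, 9)]))
  (.fold [(0, 9)]))) (.branch 169 (.branch 110 (.branch 854 (.fold [(0, 11)]) (.fold [(4, 10)]))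
  (.fold [(1, 9)])) (.branch 402 (.branch 441 (.fold [(2, 10)]) (.branch 185 (.branch 621 (.fold
  [(8, 11)]) (.fold [(2, 10)])) (.fold [(3, 9)]))) (.branch 78 (.branch 470 (.fold [(5, 10)])
  (.branch 406 (.branch 945 (.fold [(6, 11)]) (.fold [(5, 10)])) (.fold [(7, 9)]))) (.fold [(1, 2),
  (3, 5), (7, 4)]))))))) (.branch 109 (.branch 233 (.branch 78 (.branch 1201 (.fold [(10, 7)])
  (.fold [(4, 8)])) (.fold [(1, 9)])) (.fold [(6, 2)])) (.fold [(0, 7)]))) (.fold [(3, 5)])) (.fold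
  [(0, 5)])) (.branch 6 (.branch 13 (.branch 28 (.branch 242 (.fold [(3, 8)]) (.fold [(5, 0)]))
  (.branch 61 (.fold [(1, 7)]) (.branch 57 (.branch 114 (.branch 462 (.fold [(5, 9)]) (.branch 113
  (.branch 301 (.branch 910 (.fold [(4, 11)]) (.fold [(1, 10)])) (.fold [(2, 9)])) (.branch 198
  (.branch 397 (.branch 825 (.fold [(1, 11)]) (.fold [(4, 10)])) (.fold [(0, 9)])) (.branch 301
  (.branch 121 (.branch 1414 (.fold [(7, 10)]) (.fold [(1, 9)])) (.fold [(6, 9)])) (.branch 454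
  (.branch 397 (.branch 569 (.fold [(5, 9)]) (.fold [(4, 10)])) (.branch 269 (.branch 1266 (.fold
  [(3, 11)]) (.fold [(5, 9)])) (.fold [(0, 9)]))) (.branch 269 (.branch 377 (.fold [(7, 10)])
  (.branch 121 (.branch 754 (.fold [(8, 11)]) (.fold [(7, 10)])) (.fold [(6, 9)]))) (.fold [(0, 3),
  (2, 7), (6, 4)]))))))) (.fold [(1, 7)])) (.fold [(4, 6)])))) (.fold [(0, 5)])) (.branch 14
  (.branch 9 (.branch 28 (.branch 241 (.fold [(2, 8)]) (.fold [(6, 1)])) (.fold [(4, 5)])) (.branch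
  13 (.branch 28 (.branch 96 (.fold [(8, 2)]) (.branch 241 (.branch 297 (.fold [(2, 8)]) (.fold
  [(8, 2)])) (.branch 13 (.branch 78 (.branch 498 (.fold [(10, 3)]) (.fold [(5, 9)])) (.fold [(6,
  8)])) (.fold [(0, 5), (2, 3), (6, 1)])))) (.branch 82 (.branch 189 (.fold [(1, 8)]) (.branch 177
  (.branch 249 (.fold [(8, 9)]) (.branch 397 (.branch 334 (.branch 1201 (.fold [(5, 10)]) (.fold
  [(4, 9)])) (.fold [(6, 9)])) (.branch 113 (.branch 173 (.branch 910 (.fold [(4, 11)]) (.fold [(1,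
  10)])) (.fold [(2, 9)])) (.branch 241 (.branch 173 (.branch 782 (.fold [(8, 9)]) (.fold [(1,
  10)])) (.branch 141 (.branch 1394 (.fold [(3, 11)]) (.fold [(8, 9)])) (.fold [(2, 9)]))) (.branch
  141 (.branch 462 (.fold [(5, 10)]) (.branch 334 (.branch 882 (.fold [(7, 11)]) (.fold [(5, 10)]))
  (.fold [(6, 9)]))) (.fold [(0, 5), (2, 3), (6, 1)])))))) (.branch 185 (.branch 114 (.fold [(9,
  3)]) (.fold [(1, 8)])) (.fold [(4, 6)])))) (.fold [(4, 5)]))) (.fold [(0, 5)]))) (.branch 18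
  (.branch 25 (.branch 50 (.branch 173 (.fold [(1, 8)]) (.fold [(2, 6)])) (.fold [(5, 3)])) (.fold
  [(3, 5)])) (.low 1 0 3)))))) (.branch 2 (.branch 14 (.branch 18 (.branch 93 (.branch 9 (.fold
  [(8, 1)]) (.branch 6 (.branch 349 (.fold [(7, 9)]) (.fold [(8, 5)])) (.branch 160 (.branch 377
  (.fold [(1, 9)]) (.fold [(8, 2)])) (.branch 93 (.branch 270 (.fold [(7, 8)]) (.fold [(8, 7)]))
  (.branch 134 (.branch 161 (.fold [(8, 0)]) (.fold [(0, 8)])) (.branch 161 (.branch 125 (.fold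
  [(1, 9)]) (.fold [(2, 8)])) (.fold [(0, 5), (2, 3), (7, 1)]))))))) (.branch 9 (.branch 37 (.fold
  [(7, 1)]) (.branch 125 (.fold [(7, 1)]) (.fold [(2, 1)]))) (.fold [(0, 5)]))) (.branch 54 (.fold
  [(2, 1)]) (.branch 30 (.branch 113 (.branch 157 (.branch 29 (.branch 57 (.branch 1670 (.fold
  [(10, 1)]) (.fold [(9, 8)])) (.fold [(5, 6)])) (.fold [(2, 7)])) (.fold [(7, 1)])) (.fold [(4,
  3)])) (.fold [(4, 0)])))) (.branch 30 (.branch 41 (.branch 86 (.branch 93 (.branch 29 (.branch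
  153 (.branch 1606 (.fold [(10, 1)]) (.fold [(9, 8)])) (.fold [(7, 5)])) (.fold [(2, 6)])) (.fold
  [(6, 1)])) (.fold [(4, 3)])) (.fold [(3, 4)])) (.fold [(3, 0)]))) (.branch 14 (.branch 5 (.branch
  14 (.fold [(4, 6)]) (.branch 25 (.fold [(1, 6)]) (.fold [(1, 2), (3, 0), (4, 5)]))) (.branch 13
  (.branch 46 (.branch 48 (.fold [(0, 6)]) (.fold [(4, 6)])) (.branch 17 (.branch 81 (.branch 6
  (.fold [(8, 0)]) (.branch 9 (.branch 462 (.fold [(4, 9)]) (.fold [(8, 5)])) (.branch 48 (.branch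
  281 (.branch 462 (.fold [(10, 4)]) (.fold [(1, 9)])) (.fold [(8, 2)])) (.branch 25 (.branch 206
  (.fold [(9, 4)]) (.fold [(1, 8)])) (.branch 206 (.branch 29 (.fold [(8, 4)]) (.fold [(4, 8)]))
  (.fold [(1, 5), (3, 2), (4, 0)])))))) (.fold [(6, 2)])) (.branch 25 (.branch 14 (.branch 230
  (.branch 177 (.branch 240 (.branch 1801 (.fold [(10, 3)]) (.fold [(9, 2)])) (.fold [(6, 1)]))
  (.fold [(0, 8)])) (.fold [(7, 4)])) (.fold [(1, 6)])) (.branch 29 (.branch 6 (.fold [(5, 6)])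
  (.branch 14 (.fold [(7, 4)]) (.fold [(1, 6)]))) (.branch 14 (.branch 54 (.branch 113 (.branch 201
  (.branch 393 (.branch 1648 (.fold [(10, 5)]) (.fold [(9, 1)])) (.fold [(8, 2)])) (.fold [(6,
  4)])) (.fold [(0, 7)])) (.fold [(4, 6)])) (.fold [(1, 2), (3, 0), (4, 5)])))))) (.branch 9
  (.branch 21 (.branch 48 (.branch 230 (.fold [(0, 8)]) (.fold [(7, 3)])) (.branch 49 (.branch 9
  (.branch 305 (.branch 486 (.fold [(10, 0)]) (.fold [(7, 9)])) (.fold [(8, 1)])) (.branch 25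
  (.branch 206 (.fold [(9, 4)]) (.fold [(1, 8)])) (.branch 206 (.branch 153 (.fold [(8, 4)]) (.fold
  [(4, 8)])) (.fold [(1, 5), (3, 7), (4, 0)])))) (.fold [(5, 1)]))) (.branch 29 (.fold [(5, 6)])
  (.fold [(2, 1)]))) (.fold [(0, 4)])))) (.fold [(1, 2), (3, 0)]))))) (.fold [(1, 2)])) (.low 0 1
  0))) (.low 0 0 0))

set_option maxRecDepth 100000 in
theorem check_cert : check cert 1 [(1, 0)] [0, 1] [(1, 0, 0)] = true := by decide +kernel

end P5Critical

theorem four_vertex_critical_P5_free_order_le_13 {V : Type} [Fintype V]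
    (G : SimpleGraph V) (hcrit : IsVertexCritical G 4)
    (hP5 : ¬ ContainsInduced G P5) :
    Fintype.card V ≤ 13 := by
  by_contra! hcard
  obtain ⟨v⟩ : Nonempty V := Fintype.card_pos_iff.1 (by omega)
  refine (P5Critical.state_one v).check_eq_false (P5Critical.noInducedP5 hP5)
    (P5Critical.critical hcrit) hcard P5Critical.cert ?_
  rw [P5Critical.verts_one]
  exact P5Critical.check_cert
end

section
/- Let G be a connected bipartite finite simple graph. If G contains an induced subgraph isomorphic to 2K2 (the disjoint union of two edges), then G contains an induced subgraph isomorphic to P5 (the path on 5 vertices). -/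
open SimpleGraph

/-- `2K2`: four vertices `0,1,2,3` with exactly the two disjoint edges `01` and `23`. -/
def twoK2 : SimpleGraph (Fin 4) :=
  SimpleGraph.fromRel (fun a b => (a, b) = (0, 1) ∨ (a, b) = (2, 3))

/-- In a bipartite graph, a walk `a b c d e` with `a` not adjacent to `d` and `b` not adjacent
to `e` is an induced `P5`. -/
lemma containsInduced_P5_of_walk {V : Type*} {G : SimpleGraph V} (C : G.Coloring Bool)
    {a b c d e : V} (hab : G.Adj a b) (hbc : G.Adj b c) (hcd : G.Adj c d) (hde : G.Adj d e)
    (had : ¬ G.Adj a d) (hbe : ¬ G.Adj b e) : ContainsInduced G P5 := by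
  have color {x y : V} (h : G.Adj x y) : C y = !C x := by
    have := C.valid h
    revert this
    cases C x <;> cases C y <;> simp
  have not_adj {x y : V} (h : C x = C y) : ¬ G.Adj x y := fun hxy => C.valid hxy h
  have hb := color hab
  have hc := color hbc
  have hd := color hcd
  have he := color hde
  have hac : ¬ G.Adj a c := not_adj (by simp [hb, hc])
  have hae : ¬ G.Adj a e := not_adj (by simp [hb, hc, hd, he])
  have hce : ¬ G.Adj c e := not_adj (by simp [hd, he])
  have hbd : ¬ G.Adj b d := not_adj (by simp [hc, hd])
  have adj_iff : ∀ i j, P5.Adj i j ↔ G.Adj (![a, b, c, d, e] i) (![a, b, c, d, e] j) := by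
    intro i j
    fin_cases i <;> fin_cases j <;>
      simp [P5, pathGraph_adj, hab, hbc, hcd, hde, had, hbe, hac, hae, hce, hbd,
        G.adj_comm b a, G.adj_comm c b, G.adj_comm d c, G.adj_comm e d, G.adj_comm d a,
        G.adj_comm e b, G.adj_comm c a, G.adj_comm e a, G.adj_comm e c, G.adj_comm d b]
  have nac : a ≠ c := fun h => had (h ▸ hcd)
  have nae : a ≠ e := fun h => had (h ▸ hde.symm)
  have nce : c ≠ e := fun h => hbe (h ▸ hbc)
  have nbd : b ≠ d := fun h => had (h ▸ hab)
  have nad : a ≠ d := fun h => hac (h ▸ hcd.symm)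
  have nbe : b ≠ e := fun h => hae (h ▸ hab)
  refine ⟨⟨![a, b, c, d, e], fun i j h => ?_⟩, adj_iff⟩
  fin_cases i <;> fin_cases j <;>
    simp_all [hab.ne, hbc.ne, hcd.ne, hde.ne, hab.ne', hbc.ne', hcd.ne', hde.ne',
      nac.symm, nae.symm, nce.symm, nbd.symm, nad.symm, nbe.symm]

/-- In a connected bipartite graph without induced `P5`, any two vertices of the same colour
class have a common neighbour, provided that one of them has a neighbour. -/
lemma exists_common_neighbor_of_color_eq {V : Type*} {G : SimpleGraph V} (hconn : G.Connected)
    (C : G.Coloring Bool) (hP5 : ¬ ContainsInduced G P5) {u x w : V} (hux : G.Adj u x)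
    (huw : C u = C w) : ∃ y, G.Adj u y ∧ G.Adj y w := by
  have key : ∀ w, Relation.ReflTransGen G.Adj u w →
      (C u = C w → ∃ y, G.Adj u y ∧ G.Adj y w) ∧
      (C u ≠ C w → ∃ v y, G.Adj u y ∧ G.Adj y v ∧ G.Adj v w) := by
    intro w h
    induction h with
    | refl => exact ⟨fun _ => ⟨x, hux, hux.symm⟩, fun h => absurd rfl h⟩
    | @tail w z _ hwz ih =>
      have hne := C.valid hwz
      refine ⟨fun h => ?_, fun h => ?_⟩
      · obtain ⟨v, y, huy, hyv, hvw⟩ := ih.2 (fun h' => hne (h' ▸ h))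
        by_cases huw : G.Adj u w
        · exact ⟨w, huw, hwz⟩
        by_cases hyz : G.Adj y z
        · exact ⟨y, huy, hyz⟩
        exact absurd (containsInduced_P5_of_walk C huy hyv hvw hwz huw hyz) hP5
      · have huw : C u = C w := by
          revert h hne
          cases C u <;> cases C w <;> cases C z <;> simp
        obtain ⟨y, huy, hyw⟩ := ih.1 huw
        exact ⟨w, y, huy, hyw, hwz⟩
  exact (key w ((G.reachable_iff_reflTransGen u w).1 (hconn u w))).1 huw

theorem connected_bipartite_2K2_implies_P5 {V : Type} [Fintype V]
    (G : SimpleGraph V) (hconn : G.Connected) (hbip : G.Colorable 2)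
    (h : ContainsInduced G twoK2) : ContainsInduced G P5 := by
  by_contra hP5
  obtain ⟨C⟩ : Nonempty (G.Coloring Bool) := ⟨hbip.toColoring (by simp)⟩
  obtain ⟨f, hf⟩ := h
  have h01 : G.Adj (f 0) (f 1) := (hf 0 1).1 (by simp [twoK2])
  have h23 : G.Adj (f 2) (f 3) := (hf 2 3).1 (by simp [twoK2])
  have h02 : ¬ G.Adj (f 0) (f 2) := fun h => by simpa [twoK2] using (hf 0 2).2 h
  have h03 : ¬ G.Adj (f 0) (f 3) := fun h => by simpa [twoK2] using (hf 0 3).2 h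
  have h12 : ¬ G.Adj (f 1) (f 2) := fun h => by simpa [twoK2] using (hf 1 2).2 h
  have h13 : ¬ G.Adj (f 1) (f 3) := fun h => by simpa [twoK2] using (hf 1 3).2 h
  have hcol : C (f 0) = C (f 2) ∨ C (f 0) = C (f 3) := by
    have := C.valid h23
    revert this
    cases C (f 0) <;> cases C (f 2) <;> cases C (f 3) <;> simp
  rcases hcol with hcol | hcol
  · obtain ⟨y, h0y, hy2⟩ := exists_common_neighbor_of_color_eq hconn C hP5 h01 hcol
    exact hP5 (containsInduced_P5_of_walk C h01.symm h0y hy2 h23 h12 h03)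
  · obtain ⟨y, h0y, hy3⟩ := exists_common_neighbor_of_color_eq hconn C hP5 h01 hcol
    exact hP5 (containsInduced_P5_of_walk C h01.symm h0y hy3 h23.symm h13 h02)
end

section
/- Let G be a (P5,dart)-free finite simple graph containing an induced 5-cycle C with vertices v1,...,v5, and let S0, S2, S3^1 be defined with respect to C as in the context. Then S0 is anticomplete to S2 ∪ S3^1, i.e., no vertex of S0 is adjacent to a vertex of S2 ∪ S3^1. -/
open SimpleGraph

/-- `S0`: the vertices off the 5-cycle `v` with no neighbour on it. -/
def S0 {V : Type*} (G : SimpleGraph V) (v : Fin 5 → V) : Set V :=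
  {u | u ∉ Set.range v ∧ ∀ j, ¬ G.Adj u (v j)}

/-- `S2(i)`: vertices off the 5-cycle `v` whose neighbourhood on it is exactly
`{v (i-1), v (i+1)}`. -/
def S2 {V : Type*} (G : SimpleGraph V) (v : Fin 5 → V) (i : Fin 5) : Set V :=
  {u | u ∉ Set.range v ∧ ∀ j, G.Adj u (v j) ↔ (j = i - 1 ∨ j = i + 1)}

/-- `S3^1(i)`: vertices off the 5-cycle `v` whose neighbourhood on it is exactly
`{v (i-1), v i, v (i+1)}`. -/
def S31 {V : Type*} (G : SimpleGraph V) (v : Fin 5 → V) (i : Fin 5) : Set V :=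
  {u | u ∉ Set.range v ∧ ∀ j, G.Adj u (v j) ↔ (j = i - 1 ∨ j = i ∨ j = i + 1)}

/-- `S3^2(i)`: vertices off the 5-cycle `v` whose neighbourhood on it is exactly
`{v (i-2), v i, v (i+2)}`. -/
def S32 {V : Type*} (G : SimpleGraph V) (v : Fin 5 → V) (i : Fin 5) : Set V :=
  {u | u ∉ Set.range v ∧ ∀ j, G.Adj u (v j) ↔ (j = i - 2 ∨ j = i ∨ j = i + 2)}

/-- `S4(i)`: vertices off the 5-cycle `v` whose neighbourhood on it is exactly
`{v (i-2), v (i-1), v (i+1), v (i+2)}`. -/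
def S4 {V : Type*} (G : SimpleGraph V) (v : Fin 5 → V) (i : Fin 5) : Set V :=
  {u | u ∉ Set.range v ∧
    ∀ j, G.Adj u (v j) ↔ (j = i - 2 ∨ j = i - 1 ∨ j = i + 1 ∨ j = i + 2)}

/-- `S5`: vertices off the 5-cycle `v` adjacent to all five of its vertices. -/
def S5 {V : Type*} (G : SimpleGraph V) (v : Fin 5 → V) : Set V :=
  {u | u ∉ Set.range v ∧ ∀ j, G.Adj u (v j)}

/-- An induced path `p₀ p₁ p₂ p₃ p₄`, given by its ten adjacencies and non-adjacencies. Distinctness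
of the vertices is automatic, since distinct vertices of `P5` have distinct neighbourhoods. -/
theorem containsInduced_P5_s7 {V : Type*} {G : SimpleGraph V} {p₀ p₁ p₂ p₃ p₄ : V}
    (h01 : G.Adj p₀ p₁) (h12 : G.Adj p₁ p₂) (h23 : G.Adj p₂ p₃) (h34 : G.Adj p₃ p₄)
    (h02 : ¬ G.Adj p₀ p₂) (h03 : ¬ G.Adj p₀ p₃) (h04 : ¬ G.Adj p₀ p₄)
    (h13 : ¬ G.Adj p₁ p₃) (h14 : ¬ G.Adj p₁ p₄) (h24 : ¬ G.Adj p₂ p₄) :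
    ContainsInduced G P5 := by
  have hadj : ∀ x y, P5.Adj x y ↔ G.Adj (![p₀, p₁, p₂, p₃, p₄] x) (![p₀, p₁, p₂, p₃, p₄] y) := by
    intro x y
    fin_cases x <;> fin_cases y <;>
      simp [P5, pathGraph_adj, h01, h12, h23, h34, h02, h03, h04, h13, h14, h24,
        h01.symm, h12.symm, h23.symm, h34.symm, G.adj_comm p₂ p₀, G.adj_comm p₃ p₀,
        G.adj_comm p₄ p₀, G.adj_comm p₃ p₁, G.adj_comm p₄ p₁, G.adj_comm p₄ p₂]
  have htwin : ∀ x y : Fin 5, (∀ z, P5.Adj x z ↔ P5.Adj y z) → x = y := by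
    simp only [P5, pathGraph_adj]
    decide
  refine ⟨⟨![p₀, p₁, p₂, p₃, p₄], fun x y hxy => htwin x y fun z => ?_⟩, hadj⟩
  rw [hadj, hadj, hxy]

theorem S0_anticomplete_S2_S31 {V : Type} [Fintype V] (G : SimpleGraph V)
    (hP5 : ¬ ContainsInduced G P5) (hdart : ¬ ContainsInduced G dart)
    (v : Fin 5 → V) (hinj : Function.Injective v)
    (hC : ∀ i j, G.Adj (v i) (v j) ↔ C5.Adj i j) :
    ∀ a ∈ S0 G v, ∀ b ∈ (⋃ i, S2 G v i) ∪ (⋃ i, S31 G v i), ¬ G.Adj a b := by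
  intro a ha b hb hab
  obtain ⟨i, h1, h2, h3⟩ : ∃ i, G.Adj b (v (i + 1)) ∧ ¬ G.Adj b (v (i + 2)) ∧
      ¬ G.Adj b (v (i + 3)) := by
    simp only [Set.mem_union, Set.mem_iUnion] at hb
    rcases hb with ⟨i, -, h⟩ | ⟨i, -, h⟩ <;> refine ⟨i, ?_⟩ <;> simp only [h] <;>
      clear h <;> revert i <;> decide
  have hcycle : C5.Adj (i + 1) (i + 2) ∧ C5.Adj (i + 2) (i + 3) ∧ ¬ C5.Adj (i + 1) (i + 3) := by
    clear h1 h2 h3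
    revert i
    simp only [C5, fromRel_adj]
    decide
  simp only [← hC] at hcycle
  exact hP5 (containsInduced_P5_s7 hab h1 hcycle.1 hcycle.2.1 (ha.2 _) (ha.2 _) (ha.2 _) h2 h3
    hcycle.2.2)
end

section
/- Let G be a (P5,dart)-free finite simple graph containing an induced 5-cycle C with vertices v1,...,v5, and let S0, S4, S5 be defined with respect to C as in the context. Then S0 is anticomplete to S4 ∪ S5, i.e., no vertex of S0 is adjacent to a vertex of S4 ∪ S5. -/
open SimpleGraph

/-- A vertex with a neighbour in `S0` and with three consecutive neighbours on an induced
5-cycle gives an induced dart. -/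
theorem containsInduced_dart_of_adj_consecutive {V : Type*} (G : SimpleGraph V)
    (v : Fin 5 → V) (hinj : Function.Injective v)
    (hC : ∀ i j, G.Adj (v i) (v j) ↔ C5.Adj i j) {a b : V} (ha : a ∈ S0 G v)
    (hb : b ∉ Set.range v) (hab : G.Adj a b) (k : Fin 5) (h0 : G.Adj b (v k))
    (h1 : G.Adj b (v (k + 1))) (h2 : G.Adj b (v (k + 2))) :
    ContainsInduced G dart := by
  obtain ⟨har, han⟩ := ha
  have hbv : ∀ j, v j ≠ b := fun j h => hb ⟨j, h⟩
  have hav : ∀ j, v j ≠ a := fun j h => har ⟨j, h⟩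
  have hna : ∀ j, ¬ G.Adj (v j) a := fun j h => han j h.symm
  have e01 : G.Adj (v k) (v (k + 1)) := by
    rw [hC]; revert k; simp [C5]
  have e12 : G.Adj (v (k + 1)) (v (k + 2)) := by
    rw [hC]; clear h0 h1 h2 e01; revert k; simp only [C5, fromRel_adj]; decide
  have e02 : ¬ G.Adj (v k) (v (k + 2)) := by
    rw [hC]; clear h0 h1 h2 e01 e12; revert k; simp only [C5, fromRel_adj]; decide
  have n02 : v k ≠ v (k + 2) := fun h => by
    have := hinj h
    clear h0 h1 h2 e01 e12 e02 h; revert k; decide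
  have hf : Function.Injective ![v (k + 1), v k, b, v (k + 2), a] := by
    intro x y
    fin_cases x <;> fin_cases y <;>
      simp [hbv, hav, (hbv _).symm, (hav _).symm, n02, n02.symm, e01.ne, e01.ne.symm, e12.ne,
        e12.ne.symm, hab.ne, hab.ne.symm]
  refine ⟨⟨_, hf⟩, fun x y => ?_⟩
  fin_cases x <;> fin_cases y <;>
    simp [dart, han, hna, e01, e01.symm, e12, e12.symm, e02, G.adj_comm (v (k + 2)) (v k), h0,
      h1, h2, h0.symm, h1.symm, h2.symm, hab, hab.symm]

theorem S0_anticomplete_S4_S5 {V : Type} [Fintype V] (G : SimpleGraph V)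
    (hP5 : ¬ ContainsInduced G P5) (hdart : ¬ ContainsInduced G dart)
    (v : Fin 5 → V) (hinj : Function.Injective v)
    (hC : ∀ i j, G.Adj (v i) (v j) ↔ C5.Adj i j) :
    ∀ a ∈ S0 G v, ∀ b ∈ (⋃ i, S4 G v i) ∪ S5 G v, ¬ G.Adj a b := by
  rintro a ha b (hb | ⟨hbr, hb⟩) hab
  · obtain ⟨i, hbr, hb⟩ := Set.mem_iUnion.1 hb
    refine hdart (containsInduced_dart_of_adj_consecutive G v hinj hC ha hbr hab (i + 1)
      ((hb _).2 ?_) ((hb _).2 ?_) ((hb _).2 ?_)) <;>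
    · clear hb
      revert i
      decide
  · exact hdart (containsInduced_dart_of_adj_consecutive G v hinj hC ha hbr hab 0
      (hb _) (hb _) (hb _))
end

section
/- Let G be a connected (P5,dart)-free finite simple graph containing an induced 5-cycle C with vertices v1,...,v5, and let S0 be defined with respect to C as in the context. Then every connected component A of the induced subgraph G[S0] is a homogeneous set of G and is P3-free (hence A is a clique). -/
open SimpleGraph

theorem containsInduced_dart {V : Type*} {G : SimpleGraph V} {a b c d e : V}
    (hab : G.Adj a b) (hbc : G.Adj b c) (hcd : G.Adj c d) (hda : G.Adj d a)
    (hac : G.Adj a c) (hce : G.Adj c e) (hne : b ≠ d)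
    (hbd : ¬ G.Adj b d) (hae : ¬ G.Adj a e) (hbe : ¬ G.Adj b e) (hde : ¬ G.Adj d e) :
    ContainsInduced G dart := by
  have hae' : a ≠ e := by rintro rfl; exact hbe hab.symm
  have hbe' : b ≠ e := by rintro rfl; exact hae hab
  have hde' : d ≠ e := by rintro rfl; exact hae hda.symm
  have nab := hab.ne
  have nbc := hbc.ne
  have ncd := hcd.ne
  have nda := hda.ne
  have nac := hac.ne
  have nce := hce.ne
  refine ⟨⟨![a, b, c, d, e], fun i j hij => ?_⟩, fun i j => ?_⟩
  · fin_cases i <;> fin_cases j <;> simp_all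
  · fin_cases i <;> fin_cases j <;> simp [dart] <;>
      first | assumption | (rw [G.adj_comm]; assumption)

/-- A vertex with a neighbour in `S0` misses some vertex of the 5-cycle. -/
theorem exists_not_adj_of_adj_S0 {V : Type*} {G : SimpleGraph V}
    (hdart : ¬ ContainsInduced G dart) {v : Fin 5 → V} (hinj : Function.Injective v)
    (hC : ∀ i j, G.Adj (v i) (v j) ↔ C5.Adj i j)
    {u a : V} (ha : a ∈ S0 G v) (hua : G.Adj u a) : ∃ i, ¬ G.Adj u (v i) := by
  by_contra! hall
  refine hdart (containsInduced_dart (a := v 1) (b := v 0) (c := u) (d := v 2) (e := a)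
    ?_ (hall 0).symm (hall 2) ?_ (hall 1).symm hua (hinj.ne (by decide)) ?_
    (fun h => ha.2 _ h.symm) (fun h => ha.2 _ h.symm) (fun h => ha.2 _ h.symm))
  all_goals rw [hC]; simp [C5]

/-- A vertex adjacent to the 5-cycle does not distinguish adjacent vertices of `S0`. -/
theorem adj_S0_of_adj {V : Type*} {G : SimpleGraph V}
    (hP5 : ¬ ContainsInduced G P5) (hdart : ¬ ContainsInduced G dart)
    {v : Fin 5 → V} (hinj : Function.Injective v)
    (hC : ∀ i j, G.Adj (v i) (v j) ↔ C5.Adj i j)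
    {u a b : V} {i : Fin 5} (hu : G.Adj u (v i)) (ha : a ∈ S0 G v) (hb : b ∈ S0 G v)
    (hab : G.Adj a b) (hua : G.Adj u a) : G.Adj u b := by
  by_contra hub
  have step : ∀ j, G.Adj u (v j) → G.Adj u (v (j + 1)) := fun j hj => by
    by_contra hj'
    refine hP5 (containsInduced_P5 hab.symm hua.symm hj ?_ (fun h => hub h.symm)
      (hb.2 _) (hb.2 _) (ha.2 _) (ha.2 _) hj')
    rw [hC]
    simp [C5]
  obtain ⟨k, hk⟩ := exists_not_adj_of_adj_S0 hdart hinj hC ha hua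
  have h1 := step _ hu
  have h2 := step _ h1
  have h3 := step _ h2
  have h4 := step _ h3
  apply hk
  have cover : ∀ i k : Fin 5, k = i ∨ k = i + 1 ∨ k = i + 1 + 1 ∨ k = i + 1 + 1 + 1 ∨
      k = i + 1 + 1 + 1 + 1 := by decide
  rcases cover i k with rfl | rfl | rfl | rfl | rfl <;> assumption

/-- A property preserved by adjacency spreads to all reachable vertices. -/
theorem SimpleGraph.Reachable.of_adj_closed {V : Type*} {G : SimpleGraph V} {p : V → Prop}
    (hp : ∀ x y, G.Adj x y → p x → p y) {x y : V} (h : G.Reachable x y) (hx : p x) : p y := by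
  obtain ⟨w⟩ := h
  induction w with
  | nil => exact hx
  | cons hadj _ ih => exact ih (hp _ _ hadj hx)

theorem mem_image_supp_of_adj {V : Type*} {G : SimpleGraph V} {S : Set V}
    {c : (G.induce S).ConnectedComponent} {x y : V} (hx : x ∈ Subtype.val '' c.supp)
    (hy : y ∈ S) (hxy : G.Adj x y) : y ∈ Subtype.val '' c.supp := by
  obtain ⟨x, hx, rfl⟩ := hx
  exact ⟨⟨y, hy⟩, c.mem_supp_of_adj_mem_supp hx hxy, rfl⟩

theorem exists_adj_of_adj_image_supp {V : Type*} {G : SimpleGraph V} {v : Fin 5 → V}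
    {c : (G.induce (S0 G v)).ConnectedComponent} {u a : V}
    (hu : u ∉ Subtype.val '' c.supp) (ha : a ∈ Subtype.val '' c.supp) (hua : G.Adj u a) :
    ∃ i, G.Adj u (v i) := by
  by_contra! hnone
  refine hu (mem_image_supp_of_adj ha ⟨?_, hnone⟩ hua.symm)
  rintro ⟨j, rfl⟩
  obtain ⟨a, -, rfl⟩ := ha
  exact a.2.2 j hua.symm

theorem isHomogeneous_S0_component {V : Type*} {G : SimpleGraph V}
    (hP5 : ¬ ContainsInduced G P5) (hdart : ¬ ContainsInduced G dart)
    {v : Fin 5 → V} (hinj : Function.Injective v)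
    (hC : ∀ i j, G.Adj (v i) (v j) ↔ C5.Adj i j)
    (c : (G.induce (S0 G v)).ConnectedComponent) :
    IsHomogeneous G (Subtype.val '' c.supp) := by
  intro u hu
  by_contra! h
  obtain ⟨⟨b, hb, hub⟩, a, ha, hua⟩ := h
  obtain ⟨i, hi⟩ := exists_adj_of_adj_image_supp hu ha hua
  obtain ⟨a, ha, rfl⟩ := ha
  obtain ⟨b, hb, rfl⟩ := hb
  exact hub ((c.reachable_of_mem_supp ha hb).of_adj_closed (p := fun x => G.Adj u x.1)
    (fun x y hxy hx => adj_S0_of_adj hP5 hdart hinj hC hi x.2 y.2 hxy hx) hua)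

theorem S0_components_homogeneous_P3_free {V : Type} [Fintype V] (G : SimpleGraph V)
    (hconn : G.Connected)
    (hP5 : ¬ ContainsInduced G P5) (hdart : ¬ ContainsInduced G dart)
    (v : Fin 5 → V) (hinj : Function.Injective v)
    (hC : ∀ i j, G.Adj (v i) (v j) ↔ C5.Adj i j)
    (c : (G.induce (S0 G v)).ConnectedComponent) :
    IsHomogeneous G (Subtype.val '' c.supp) ∧
    ¬ ContainsInduced (G.induce (Subtype.val '' c.supp)) (SimpleGraph.pathGraph 3) := by
  have hom := isHomogeneous_S0_component hP5 hdart hinj hC c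
  refine ⟨hom, ?_⟩
  rintro ⟨f, hf⟩
  have outside : v 0 ∉ Subtype.val '' c.supp := by
    rintro ⟨x, -, hx⟩
    exact x.2.1 ⟨0, hx.symm⟩
  obtain ⟨a, ha, u, hu, hau⟩ :
      ∃ a ∈ Subtype.val '' c.supp, ∃ u ∉ Subtype.val '' c.supp, G.Adj a u := by
    by_contra! closed
    exact outside ((hconn.preconnected (f 0) (v 0)).of_adj_closed
      (p := fun x => x ∈ Subtype.val '' c.supp)
      (fun x y hxy hx => by_contra fun hy => closed x hx y hy hxy) (f 0).2)
  obtain ⟨i, hi⟩ := exists_adj_of_adj_image_supp hu ha hau.symm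
  have complete := (hom u hu).resolve_right fun h => h a ha hau.symm
  have no_adj : ∀ x ∈ Subtype.val '' c.supp, ¬ G.Adj x (v i) := by
    rintro _ ⟨x, -, rfl⟩
    exact x.2.2 i
  have h01 : G.Adj (f 0) (f 1) := (hf 0 1).1 (by simp [pathGraph_adj])
  have h12 : G.Adj (f 1) (f 2) := (hf 1 2).1 (by simp [pathGraph_adj])
  have h02 : ¬ G.Adj (f 0) (f 2) := fun h => by
    have := (hf 0 2).2 h
    simp [pathGraph_adj] at this
  have hne : (f 0 : V) ≠ f 2 := fun h => by
    simpa using f.injective (Subtype.ext h)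
  exact hdart (containsInduced_dart h01.symm (complete _ (f 0).2).symm (complete _ (f 2).2)
    h12.symm (complete _ (f 1).2).symm hi hne h02 (no_adj _ (f 1).2) (no_adj _ (f 0).2)
    (no_adj _ (f 2).2))
end

section
/- Let G be a (P5,dart)-free finite simple graph containing an induced 5-cycle C with vertices v1,...,v5, and let the sets S2(i) be defined with respect to C as in the context. Then for each 1 ≤ i ≤ 5, S2(i) is complete to S2(i+1) ∪ S2(i−1), i.e., every vertex of S2(i) is adjacent to every vertex of S2(i+1) ∪ S2(i−1). -/
open SimpleGraph

/-- If `a ∈ S2(i)` and `b ∈ S2(i + 1)` were not adjacent, then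
`b, v (i + 2), v (i + 3), v (i + 4), a` would be an induced path. -/
theorem adj_of_mem_S2_of_mem_S2_succ {V : Type*} {G : SimpleGraph V}
    (hP5 : ¬ ContainsInduced G P5) {v : Fin 5 → V}
    (hC : ∀ i j, G.Adj (v i) (v j) ↔ C5.Adj i j) {i : Fin 5} {a b : V}
    (ha : a ∈ S2 G v i) (hb : b ∈ S2 G v (i + 1)) : G.Adj a b := by
  by_contra hab
  have hba : ¬ G.Adj b a := fun h => hab h.symm
  have ha' : ∀ j, G.Adj (v j) a ↔ (j = i - 1 ∨ j = i + 1) :=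
    fun j => (G.adj_comm _ _).trans (ha.2 j)
  have hb' : ∀ j, G.Adj (v j) b ↔ (j = i + 1 - 1 ∨ j = i + 1 + 1) :=
    fun j => (G.adj_comm _ _).trans (hb.2 j)
  have hadj : ∀ x y, P5.Adj x y ↔
      G.Adj (![b, v (i + 2), v (i + 3), v (i + 4), a] x)
        (![b, v (i + 2), v (i + 3), v (i + 4), a] y) := by
    intro x y
    fin_cases x <;> fin_cases y <;>
      simp [hab, hba, ha.2, hb.2, ha', hb', hC, P5, C5, SimpleGraph.pathGraph_adj] <;>
      clear ha hb ha' hb' <;> revert i <;> decide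
  have hinj : Function.Injective ![b, v (i + 2), v (i + 3), v (i + 4), a] := by
    intro x y hxy
    have hnbr : ∀ z, P5.Adj x z ↔ P5.Adj y z := fun z => by rw [hadj, hadj, hxy]
    simp only [P5, SimpleGraph.pathGraph_adj] at hnbr
    clear hxy
    revert x y
    decide
  exact hP5 ⟨⟨_, hinj⟩, hadj⟩

theorem S2_complete_S2_neighbours {V : Type} [Fintype V] (G : SimpleGraph V)
    (hP5 : ¬ ContainsInduced G P5) (hdart : ¬ ContainsInduced G dart)
    (v : Fin 5 → V) (hinj : Function.Injective v)
    (hC : ∀ i j, G.Adj (v i) (v j) ↔ C5.Adj i j) :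
    ∀ i : Fin 5, ∀ a ∈ S2 G v i, ∀ b ∈ S2 G v (i + 1) ∪ S2 G v (i - 1), G.Adj a b := by
  rintro i a ha b (hb | hb)
  · exact adj_of_mem_S2_of_mem_S2_succ hP5 hC ha hb
  · exact (adj_of_mem_S2_of_mem_S2_succ hP5 hC hb (by rwa [sub_add_cancel])).symm
end

section
/- Let G be a (P5,dart)-free finite simple graph containing an induced 5-cycle C with vertices v1,...,v5, and let the sets S3^1(i), S3^2(i), S4(i) be defined with respect to C as in the context. Then for each 1 ≤ i ≤ 5, each of the sets S3^1(i), S3^2(i) and S4(i) is a clique of G. -/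
open SimpleGraph

/-- In a dart-free graph, vertices `x`, `y` are equal or adjacent as soon as they have adjacent
common neighbours `a`, `c` and `c` has a further neighbour `e` that sees none of `a`, `x`, `y`. -/
theorem eq_or_adj_of_dart_free {V : Type*} {G : SimpleGraph V} (hdart : ¬ ContainsInduced G dart)
    {x y a c e : V} (hac : G.Adj a c) (hxa : G.Adj x a) (hxc : G.Adj x c) (hya : G.Adj y a)
    (hyc : G.Adj y c) (hce : G.Adj c e) (hae : ¬ G.Adj a e) (hxe : ¬ G.Adj x e)
    (hye : ¬ G.Adj y e) : x = y ∨ G.Adj x y := by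
  by_contra! h
  obtain ⟨hne, hxy⟩ := h
  have hae' : a ≠ e := by rintro rfl; exact hxe hxa
  have hxe' : x ≠ e := by rintro rfl; exact hae hxa.symm
  have hye' : y ≠ e := by rintro rfl; exact hae hya.symm
  refine hdart ⟨⟨![a, x, c, y, e], ?_⟩, ?_⟩
  · intro i j h
    fin_cases i <;> fin_cases j <;>
      simp_all [hac.ne, hac.ne', hxa.ne, hxa.ne', hxc.ne, hxc.ne', hya.ne, hya.ne', hyc.ne,
        hyc.ne', hce.ne, hce.ne']
  · intro i j
    change dart.Adj i j ↔ G.Adj (![a, x, c, y, e] i) (![a, x, c, y, e] j)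
    fin_cases i <;> fin_cases j <;>
      simp [dart, hac, hxa, hxc, hya, hyc, hce, hae, hxe, hye, hxy, hac.symm, hxa.symm,
        hxc.symm, hya.symm, hyc.symm, hce.symm, mt SimpleGraph.Adj.symm hae,
        mt SimpleGraph.Adj.symm hxe, mt SimpleGraph.Adj.symm hye, mt SimpleGraph.Adj.symm hxy]

theorem S31_S32_S4_cliques {V : Type} [Fintype V] (G : SimpleGraph V)
    (hP5 : ¬ ContainsInduced G P5) (hdart : ¬ ContainsInduced G dart)
    (v : Fin 5 → V) (hinj : Function.Injective v)
    (hC : ∀ i j, G.Adj (v i) (v j) ↔ C5.Adj i j) :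
    ∀ i : Fin 5, G.IsClique (S31 G v i) ∧ G.IsClique (S32 G v i) ∧ G.IsClique (S4 G v i) := by
  have key : ∀ (j k l : Fin 5) (P : Fin 5 → Prop), P j → P k → ¬ P l →
      C5.Adj j k → C5.Adj k l → ¬ C5.Adj j l →
      G.IsClique {u | u ∉ Set.range v ∧ ∀ m, G.Adj u (v m) ↔ P m} := by
    intro j k l P hj hk hl hjk hkl hjl x hx y hy hne
    exact (eq_or_adj_of_dart_free hdart ((hC j k).2 hjk) ((hx.2 j).2 hj) ((hx.2 k).2 hk)
      ((hy.2 j).2 hj) ((hy.2 k).2 hk) ((hC k l).2 hkl) (fun h => hjl ((hC j l).1 h))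
      (fun h => hl ((hx.2 l).1 h)) (fun h => hl ((hy.2 l).1 h))).resolve_left hne
  have hadj : ∀ j k, C5.Adj j k ↔ j ≠ k ∧ (k = j + 1 ∨ j = k + 1) :=
    fun j k => SimpleGraph.fromRel_adj _ j k
  simp only [hadj] at key
  intro i
  refine ⟨key i (i + 1) (i + 2) _ ?_ ?_ ?_ ?_ ?_ ?_,
    key (i + 2) (i - 2) (i - 1) _ ?_ ?_ ?_ ?_ ?_ ?_,
    key (i + 2) (i + 1) i _ ?_ ?_ ?_ ?_ ?_ ?_⟩ <;>
    revert i <;> decide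
end
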